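/- arXiv:1904.12001 — 2 statements merged into one kernel-verified Lean document; each statement's English description precedes it below -/
import Mathlib

section
/- Let ξ ∈ ℝ with 0 < ξ < α, and let u ∈ C²([0,R)) with u(0) = ξ and u'(0) = 0 be the solution of the radial Pucci equation for M⁻ on its maximal interval of existence [0,R). Then R = +∞, u is oscillating (it has an unbounded sequence of zeros), u is localized (u(r), u'(r), u''(r) → 0 as r → +∞), and sup_{r ≥ 0} |u(r)| = ξ < α. -/
open Set Filter Topology

/-- The coefficient selected by the sign of `x` in the one-dimensional operator `M⁻`. -/
noncomputable def pucciCoef (lam Lam x : ℝ) : ℝ := if 0 ≤ x then lam else Lam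

theorem pucciCoef_mem_Icc {lam Lam : ℝ} (h : lam ≤ Lam) (x : ℝ) :
    pucciCoef lam Lam x ∈ Icc lam Lam := by
  unfold pucciCoef
  split_ifs
  · exact ⟨le_rfl, h⟩
  · exact ⟨h, le_rfl⟩

theorem pucciCoef_mul_self {lam Lam : ℝ} (h : lam ≤ Lam) (x : ℝ) :
    pucciCoef lam Lam x * x = min (lam * x) (Lam * x) := by
  unfold pucciCoef
  split_ifs with hx
  · rw [min_eq_left (by gcongr)]
  · rw [min_eq_right]
    nlinarith

/-- `y ↦ max (y / lam) (y / Lam)` is the inverse of `x ↦ pucciCoef lam Lam x * x`. -/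
theorem pucciCoef_mul_eq_iff {lam Lam : ℝ} (h0 : 0 < lam) (h : lam ≤ Lam) (x y : ℝ) :
    pucciCoef lam Lam x * x = y ↔ x = max (y / lam) (y / Lam) := by
  have hL : 0 < Lam := h0.trans_le h
  have key : ∀ x, max (pucciCoef lam Lam x * x / lam) (pucciCoef lam Lam x * x / Lam) = x := by
    intro x
    unfold pucciCoef
    split_ifs with hx
    · rw [mul_div_cancel_left₀ _ h0.ne', max_eq_left]
      rw [div_le_iff₀ hL]; nlinarith
    · rw [mul_div_cancel_left₀ _ hL.ne', max_eq_right]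
      rw [div_le_iff₀ h0]; nlinarith
  constructor
  · rintro rfl
    exact (key x).symm
  · rintro rfl
    unfold pucciCoef
    rcases le_or_gt 0 y with hy | hy
    · have : y / Lam ≤ y / lam := by gcongr
      rw [max_eq_left this, if_pos (by positivity)]
      field_simp
    · have : y / lam ≤ y / Lam := by
        rw [div_le_div_iff₀ h0 hL]; nlinarith
      rw [max_eq_right this, if_neg (not_le.2 (div_neg_of_neg_of_pos hy hL))]
      field_simp

/-- Pointwise dissipation: the quantity paired with `u'` is the derivative of the energy. -/
theorem pucci_dissipation {lam Lam : ℝ} (h0 : 0 < lam) (h : lam ≤ Lam) {a p k c : ℝ} (hk : 0 ≤ k)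
    (heq : pucciCoef lam Lam a * a + k * (pucciCoef lam Lam p * p) + c = 0) :
    p * (a + min (c / Lam) (c / lam)) ≤ -(lam / Lam * k) * p ^ 2 := by
  have hL : 0 < Lam := h0.trans_le h
  have ha : a = max ((-(k * (pucciCoef lam Lam p * p)) - c) / lam)
      ((-(k * (pucciCoef lam Lam p * p)) - c) / Lam) := by
    rw [← pucciCoef_mul_eq_iff h0 h]; linarith
  obtain ⟨hψ1, hψ2⟩ := pucciCoef_mem_Icc h p
  set ψ := pucciCoef lam Lam p
  set b := k * (ψ * p) with hb
  have hmin : min (c / Lam) (c / lam) = - max ((-c) / lam) ((-c) / Lam) := by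
    rw [neg_div, neg_div, max_neg_neg, neg_neg, min_comm]
  have hinv : lam / Lam ≤ 1 := (div_le_one hL).2 h
  have hLl : Lam⁻¹ ≤ lam⁻¹ := inv_anti₀ h0 h
  have strong : ∀ x y : ℝ, x ≤ y →
      (y - x) / Lam ≤ max (y / lam) (y / Lam) - max (x / lam) (x / Lam) := by
    intro x y hxy
    have e1 : x / lam + (y - x) / Lam ≤ y / lam := by
      simp only [div_eq_mul_inv]; nlinarith
    have e2 : x / Lam + (y - x) / Lam = y / Lam := by ring
    rw [le_sub_iff_add_le', ← max_add_add_right]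
    exact max_le_max e1 e2.le
  rw [hmin, ha]
  have hpsi : lam / Lam * k ≤ k * ψ / Lam := by
    rw [div_mul_eq_mul_div]; gcongr ?_ / Lam; nlinarith
  rcases le_total 0 p with hp | hp
  · have hbp : 0 ≤ b := by have := h0.le.trans hψ1; positivity
    have := strong (-b - c) (-c) (by linarith)
    have e : (-c - (-b - c)) / Lam = k * ψ / Lam * p := by rw [hb]; ring
    nlinarith [mul_le_mul_of_nonneg_right hpsi hp, mul_le_mul_of_nonneg_left this hp,
      mul_le_mul_of_nonneg_right hpsi (sq_nonneg p)]
  · have hbp : b ≤ 0 := by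
      have := h0.le.trans hψ1
      exact mul_nonpos_of_nonneg_of_nonpos hk (mul_nonpos_of_nonneg_of_nonpos this hp)
    have := strong (-c) (-b - c) (by linarith)
    have e : ((-b - c) - -c) / Lam = -(k * ψ / Lam * p) := by rw [hb]; ring
    nlinarith [mul_le_mul_of_nonpos_left this hp,
      mul_le_mul_of_nonneg_right hpsi (sq_nonneg p)]

/-- Bound for `u u''` when the friction coefficient `k` is small and `m u² ≤ u g(u)`. -/
theorem pucci_mul_second_le {lam Lam : ℝ} (h0 : 0 < lam) (h : lam ≤ Lam) {a p k c t m : ℝ}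
    (hk : 0 ≤ k) (hkm : (k * Lam) ^ 2 ≤ lam * m) (hm : 0 < m) (hc : m * t ^ 2 ≤ t * c)
    (heq : pucciCoef lam Lam a * a + k * (pucciCoef lam Lam p * p) + c = 0) :
    t * a ≤ p ^ 2 / 2 - m / (2 * Lam) * t ^ 2 := by
  have hL : 0 < Lam := h0.trans_le h
  obtain ⟨hψ1, hψ2⟩ := pucciCoef_mem_Icc h p
  obtain ⟨hφ1, hφ2⟩ := pucciCoef_mem_Icc h a
  set ψ := pucciCoef lam Lam p
  set φ := pucciCoef lam Lam a
  have hφ : 0 < φ := h0.trans_le hφ1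
  have hkψ : (k * ψ) ^ 2 ≤ lam * m :=
    (pow_le_pow_left₀ (mul_nonneg hk (h0.le.trans hψ1)) (by gcongr) 2).trans hkm
  have young : -(k * ψ) * (t * p) ≤ lam * p ^ 2 / 2 + m / 2 * t ^ 2 := by
    have h1 : 0 ≤ (lam * p + k * ψ * t) ^ 2 := sq_nonneg _
    have h2 : (k * ψ) ^ 2 * t ^ 2 ≤ lam * m * t ^ 2 := by gcongr
    have : lam * (-(k * ψ) * (t * p)) ≤ lam * (lam * p ^ 2 / 2 + m / 2 * t ^ 2) := by nlinarith
    exact le_of_mul_le_mul_left this h0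
  have h1 : φ * (t * a) ≤ lam * p ^ 2 / 2 - m / 2 * t ^ 2 := by
    have : φ * (t * a) = -(k * ψ) * (t * p) - t * c := by linear_combination t * heq
    linarith
  have h2 : φ * (t * a) ≤ φ * (p ^ 2 / 2 - m / (2 * Lam) * t ^ 2) := by
    have e1 : lam * p ^ 2 / 2 ≤ φ * (p ^ 2 / 2) := by nlinarith [sq_nonneg p]
    have e2 : φ * (m / (2 * Lam) * t ^ 2) ≤ m / 2 * t ^ 2 := by
      calc φ * (m / (2 * Lam) * t ^ 2) ≤ Lam * (m / (2 * Lam) * t ^ 2) := by gcongr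
        _ = m / 2 * t ^ 2 := by field_simp
    linarith
  exact le_of_mul_le_mul_left h2 hφ

theorem exists_slope_bounds {g : ℝ → ℝ} (hg : Continuous g) (hodd : ∀ t, g (-t) = -g t)
    {α : ℝ} (hpos : ∀ t, 0 < t → t < α → 0 < g t) {d : ℝ} (hd : HasDerivAt g d 0)
    (hd0 : 0 < d) {ξ : ℝ} (hξ : 0 < ξ) (hξα : ξ < α) :
    ∃ m > 0, ∃ L > 0, ∀ t ∈ Icc (-ξ) ξ, m * t ^ 2 ≤ t * g t ∧ t * g t ≤ L * t ^ 2 := by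
  have hg0 : g 0 = 0 := by have := hodd 0; simp at this; linarith
  have hcont : ContinuousOn (dslope g 0) (Icc (-ξ) ξ) :=
    ((continuousOn_dslope (univ_mem)).2 ⟨hg.continuousOn, hd.differentiableAt⟩).mono
      (subset_univ _)
  have hne : (Icc (-ξ) ξ).Nonempty := ⟨0, by simp [hξ.le]⟩
  have hs : ∀ t, t * g t = dslope g 0 t * t ^ 2 := by
    intro t
    rcases eq_or_ne t 0 with rfl | ht
    · simp
    · rw [dslope_of_ne _ ht, slope_def_field, hg0]
      simp only [sub_zero]
      field_simp
  have hp : ∀ t ∈ Icc (-ξ) ξ, 0 < dslope g 0 t := by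
    intro t ht
    rcases lt_trichotomy t 0 with h | rfl | h
    · rw [dslope_of_ne _ h.ne, slope_def_field, hg0]
      have := hpos (-t) (by linarith) (by linarith [ht.1])
      rw [hodd] at this
      exact div_pos_of_neg_of_neg (by linarith) (by linarith)
    · rw [dslope_same, hd.deriv]; exact hd0
    · rw [dslope_of_ne _ h.ne', slope_def_field, hg0]
      have := hpos t h (by linarith [ht.2])
      simpa using div_pos this h
  obtain ⟨t0, ht0, hmin⟩ := isCompact_Icc.exists_isMinOn hne hcont
  obtain ⟨t1, ht1, hmax⟩ := isCompact_Icc.exists_isMaxOn hne hcont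
  refine ⟨_, hp t0 ht0, _, hp t1 ht1, fun t ht => ?_⟩
  rw [hs]
  exact ⟨mul_le_mul_of_nonneg_right (hmin ht) (sq_nonneg t),
    mul_le_mul_of_nonneg_right (hmax ht) (sq_nonneg t)⟩

/-- A function whose derivative has the sign of its argument is minimal at the origin. -/
theorem le_of_mul_deriv_nonneg {φ φ' : ℝ → ℝ} (hφ : ∀ t, HasDerivAt φ (φ' t) t) {ξ : ℝ}
    (h : ∀ t ∈ Icc (-ξ) ξ, 0 ≤ t * φ' t) {t : ℝ} (ht : t ∈ Icc (-ξ) ξ) : φ 0 ≤ φ t := by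
  have hc : Continuous φ := continuous_iff_continuousAt.2 fun t => (hφ t).continuousAt
  rcases le_total 0 t with h0 | h0
  · refine monotoneOn_of_deriv_nonneg (convex_Icc 0 t) hc.continuousOn
      (fun s _ => (hφ s).differentiableAt.differentiableWithinAt) (fun s hs => ?_)
      (left_mem_Icc.2 h0) (right_mem_Icc.2 h0) h0
    rw [interior_Icc] at hs
    rw [(hφ s).deriv]
    exact nonneg_of_mul_nonneg_right (h s ⟨by linarith [hs.1, ht.2], by linarith [hs.2, ht.2]⟩) hs.1
  · refine antitoneOn_of_deriv_nonpos (convex_Icc t 0) hc.continuousOn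
      (fun s _ => (hφ s).differentiableAt.differentiableWithinAt) (fun s hs => ?_)
      (left_mem_Icc.2 h0) (right_mem_Icc.2 h0) h0
    rw [interior_Icc] at hs
    rw [(hφ s).deriv]
    have := h s ⟨by linarith [hs.1, ht.1], by linarith [hs.2, ht.1]⟩
    by_contra! hcon
    nlinarith [hs.2]

/-- The radial equation for `M⁻` at radius `r`, with `k` in the role of `N - 1`. -/
def PucciRadialEq (lam Lam k : ℝ) (g u : ℝ → ℝ) (r : ℝ) : Prop :=
  pucciCoef lam Lam (deriv (deriv u) r) * deriv (deriv u) r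
    + k / r * (pucciCoef lam Lam (deriv u r) * deriv u r) + g (u r) = 0

/-- The half-open interval `[0, R)` for an extended real `R`. -/
def radialDomain (R : EReal) : Set ℝ := {r : ℝ | 0 ≤ r ∧ (r : EReal) < R}

/-- The open interval `(0, R)` for an extended real `R`. -/
def radialInterior (R : EReal) : Set ℝ := {r : ℝ | 0 < r ∧ (r : EReal) < R}

theorem isOpen_radialInterior (R : EReal) : IsOpen (radialInterior R) :=
  isOpen_Ioi.inter (isOpen_Iio.preimage continuous_coe_real_ereal)

theorem radialInterior_subset (R : EReal) : radialInterior R ⊆ radialDomain R :=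
  fun _ h => ⟨h.1.le, h.2⟩

theorem ordConnected_radialDomain (R : EReal) : (radialDomain R).OrdConnected :=
  ⟨fun _ hx _ hy _ hz => ⟨hx.1.trans hz.1, (EReal.coe_le_coe_iff.2 hz.2).trans_lt hy.2⟩⟩

theorem ordConnected_radialInterior (R : EReal) : (radialInterior R).OrdConnected :=
  ⟨fun _ hx _ hy _ hz => ⟨hx.1.trans_le hz.1, (EReal.coe_le_coe_iff.2 hz.2).trans_lt hy.2⟩⟩

theorem uniqueDiffOn_radialDomain (R : EReal) : UniqueDiffOn ℝ (radialDomain R) :=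
  (uniqueDiffOn_Ici 0).inter (isOpen_Iio.preimage continuous_coe_real_ereal)

theorem zero_mem_radialDomain {R : EReal} (hR : 0 < R) : (0 : ℝ) ∈ radialDomain R :=
  ⟨le_rfl, by simpa using hR⟩

theorem eventually_mem_radialInterior {R : EReal} (hR : 0 < R) :
    ∀ᶠ r in 𝓝[>] (0 : ℝ), r ∈ radialInterior R := by
  have h : ∀ᶠ r : ℝ in 𝓝 0, (r : EReal) < R :=
    (isOpen_Iio.preimage continuous_coe_real_ereal).mem_nhds (by simpa using hR)
  filter_upwards [self_mem_nhdsWithin, h.filter_mono nhdsWithin_le_nhds] with r h1 h2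
  exact ⟨h1, h2⟩

section Regularity

variable {R : EReal} {u : ℝ → ℝ}

theorem contDiffOn_deriv_radialInterior (hu : ContDiffOn ℝ 2 u (radialDomain R)) :
    DifferentiableOn ℝ u (radialInterior R) ∧ ContDiffOn ℝ 1 (deriv u) (radialInterior R) := by
  have := hu.mono (radialInterior_subset R)
  rw [show (2 : WithTop ℕ∞) = 1 + 1 by norm_num,
    contDiffOn_succ_iff_deriv_of_isOpen (isOpen_radialInterior R)] at this
  exact ⟨this.1, this.2.2⟩

theorem hasDerivAt_of_mem_radialInterior (hu : ContDiffOn ℝ 2 u (radialDomain R)) {r : ℝ}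
    (hr : r ∈ radialInterior R) : HasDerivAt u (deriv u r) r :=
  ((contDiffOn_deriv_radialInterior hu).1.differentiableAt
    ((isOpen_radialInterior R).mem_nhds hr)).hasDerivAt

theorem hasDerivAt_deriv_of_mem_radialInterior (hu : ContDiffOn ℝ 2 u (radialDomain R)) {r : ℝ}
    (hr : r ∈ radialInterior R) : HasDerivAt (deriv u) (deriv (deriv u) r) r :=
  (((contDiffOn_deriv_radialInterior hu).2.differentiableOn one_ne_zero).differentiableAt
    ((isOpen_radialInterior R).mem_nhds hr)).hasDerivAt

theorem exists_eventually_abs_deriv_deriv_le (hR : 0 < R)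
    (hu : ContDiffOn ℝ 2 u (radialDomain R)) :
    ∃ B, ∀ᶠ r in 𝓝[>] (0 : ℝ), |deriv (deriv u) r| ≤ B := by
  set S := radialDomain R
  have hS := uniqueDiffOn_radialDomain R
  have h1 : ContDiffOn ℝ 1 (derivWithin u S) S := hu.derivWithin hS (by norm_num)
  have h2 : ContinuousOn (derivWithin (derivWithin u S) S) S :=
    ((contDiffOn_one_iff_derivWithin hS).1 h1).2
  have e1 : ∀ r ∈ radialInterior R, derivWithin u S r = deriv u r := fun r hr =>
    derivWithin_of_mem_nhds (mem_of_superset ((isOpen_radialInterior R).mem_nhds hr)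
      (radialInterior_subset R))
  have e2 : ∀ r ∈ radialInterior R,
      derivWithin (derivWithin u S) S r = deriv (deriv u) r := fun r hr => by
    rw [derivWithin_of_mem_nhds (mem_of_superset ((isOpen_radialInterior R).mem_nhds hr)
      (radialInterior_subset R))]
    apply Filter.EventuallyEq.deriv_eq
    filter_upwards [(isOpen_radialInterior R).mem_nhds hr] with s hs using e1 s hs
  have h3 := (h2 0 (zero_mem_radialDomain hR)).abs.mono_left
    (nhdsWithin_mono _ (radialInterior_subset R))
  set B := |derivWithin (derivWithin u S) S 0|
  refine ⟨B + 1, ?_⟩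
  have h4 : ∀ᶠ r in 𝓝[radialInterior R] (0 : ℝ), |derivWithin (derivWithin u S) S r| < B + 1 :=
    h3.eventually (gt_mem_nhds (lt_add_one B))
  have h5 : 𝓝[>] (0 : ℝ) ≤ 𝓝[radialInterior R] 0 :=
    le_inf nhdsWithin_le_nhds (le_principal_iff.2 (eventually_mem_radialInterior hR))
  filter_upwards [h5 h4, eventually_mem_radialInterior hR] with r hr hr'
  rw [← e2 r hr']
  exact le_of_lt hr

theorem tendsto_nhdsGT_zero (hR : 0 < R) (hu : ContDiffOn ℝ 2 u (radialDomain R)) :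
    Tendsto u (𝓝[>] 0) (𝓝 (u 0)) := by
  have h5 : 𝓝[>] (0 : ℝ) ≤ 𝓝[radialDomain R] 0 :=
    le_inf nhdsWithin_le_nhds (le_principal_iff.2
      ((eventually_mem_radialInterior hR).mono fun _ h => radialInterior_subset R h))
  exact (hu.continuousOn 0 (zero_mem_radialDomain hR)).mono_left h5

/-- The equation forces the one-sided derivative at the origin to vanish. -/
theorem tendsto_deriv_nhdsGT_zero {lam Lam k : ℝ} {g : ℝ → ℝ} (h0 : 0 < lam) (h : lam ≤ Lam)
    (hk : 0 < k) (hg : Continuous g) (hR : 0 < R) (hu : ContDiffOn ℝ 2 u (radialDomain R))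
    (hode : ∀ r ∈ radialInterior R, PucciRadialEq lam Lam k g u r) :
    Tendsto (deriv u) (𝓝[>] 0) (𝓝 0) := by
  have hL : 0 < Lam := h0.trans_le h
  obtain ⟨B, hB⟩ := exists_eventually_abs_deriv_deriv_le hR hu
  have hgu : Tendsto (fun r => |g (u r)|) (𝓝[>] 0) (𝓝 |g (u 0)|) :=
    ((hg.tendsto _).comp (tendsto_nhdsGT_zero hR hu)).abs
  have hC := hgu.eventually (gt_mem_nhds (lt_add_one _))
  set C := |g (u 0)| + 1
  have hlim : Tendsto (fun r : ℝ => r * ((Lam * B + C) / (k * lam))) (𝓝[>] 0) (𝓝 0) := by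
    have : Tendsto (fun r : ℝ => r * ((Lam * B + C) / (k * lam))) (𝓝 0) (𝓝 (0 * _)) :=
      tendsto_id.mul tendsto_const_nhds
    rw [zero_mul] at this
    exact this.mono_left nhdsWithin_le_nhds
  refine squeeze_zero_norm' ?_ hlim
  filter_upwards [hB, hC, eventually_mem_radialInterior hR] with r hr1 hr2 hr
  have hr0 : 0 < r := hr.1
  have heq := hode r hr
  unfold PucciRadialEq at heq
  obtain ⟨ha1, ha2⟩ := pucciCoef_mem_Icc h (deriv (deriv u) r)
  obtain ⟨hb1, hb2⟩ := pucciCoef_mem_Icc h (deriv u r)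
  set φ := pucciCoef lam Lam (deriv (deriv u) r)
  set ψ := pucciCoef lam Lam (deriv u r)
  have e : k * ψ * deriv u r = - (r * (φ * deriv (deriv u) r + g (u r))) := by
    field_simp at heq
    linear_combination heq
  have hφ := h0.trans_le ha1
  have hψ := h0.trans_le hb1
  have e2 : k * ψ * |deriv u r| = r * |φ * deriv (deriv u) r + g (u r)| := by
    rw [← abs_of_pos (mul_pos hk hψ), ← abs_mul, e, abs_neg, abs_mul, abs_of_pos hr0]
  have e3 : |φ * deriv (deriv u) r + g (u r)| ≤ Lam * B + C := by
    refine (abs_add_le _ _).trans (add_le_add ?_ hr2.le)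
    rw [abs_mul, abs_of_pos hφ]
    exact mul_le_mul ha2 hr1 (abs_nonneg _) hL.le
  rw [Real.norm_eq_abs, mul_div_assoc', le_div_iff₀ (by positivity)]
  calc |deriv u r| * (k * lam) ≤ |deriv u r| * (k * ψ) := by gcongr
    _ = r * |φ * deriv (deriv u) r + g (u r)| := by rw [← e2]; ring
    _ ≤ _ := by gcongr

end Regularity

/-- The nonlinearity seen by the energy `u'² / 2 + pucciPotential u`. -/
noncomputable def pucciForce (lam Lam : ℝ) (g : ℝ → ℝ) (t : ℝ) : ℝ := min (g t / Lam) (g t / lam)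

noncomputable def pucciPotential (lam Lam : ℝ) (g : ℝ → ℝ) (t : ℝ) : ℝ :=
  ∫ s in (0 : ℝ)..t, pucciForce lam Lam g s

theorem hasDerivAt_pucciPotential {lam Lam : ℝ} {g : ℝ → ℝ} (hg : Continuous g) (t : ℝ) :
    HasDerivAt (pucciPotential lam Lam g) (pucciForce lam Lam g t) t := by
  have hc : Continuous (pucciForce lam Lam g) := by unfold pucciForce; fun_prop
  exact intervalIntegral.integral_hasDerivAt_right (hc.intervalIntegrable _ _)
    hc.aestronglyMeasurable.stronglyMeasurableAtFilter hc.continuousAt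

theorem pucciPotential_zero {lam Lam : ℝ} {g : ℝ → ℝ} : pucciPotential lam Lam g 0 = 0 :=
  intervalIntegral.integral_same

theorem continuous_pucciPotential {lam Lam : ℝ} {g : ℝ → ℝ} (hg : Continuous g) :
    Continuous (pucciPotential lam Lam g) :=
  continuous_iff_continuousAt.2 fun t => (hasDerivAt_pucciPotential hg t).continuousAt

theorem pucciForce_of_nonneg {lam Lam : ℝ} (h0 : 0 < lam) (h : lam ≤ Lam) {g : ℝ → ℝ} {t : ℝ}
    (ht : 0 ≤ g t) : pucciForce lam Lam g t = g t / Lam :=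
  min_eq_left (by gcongr)

theorem pucciForce_of_nonpos {lam Lam : ℝ} (h0 : 0 < lam) (h : lam ≤ Lam) {g : ℝ → ℝ} {t : ℝ}
    (ht : g t ≤ 0) : pucciForce lam Lam g t = g t / lam := by
  refine min_eq_right ?_
  rw [div_le_div_iff₀ h0 (h0.trans_le h)]
  nlinarith

theorem strictMonoOn_pucciPotential {lam Lam α : ℝ} (h0 : 0 < lam) (h : lam ≤ Lam) {g : ℝ → ℝ}
    (hg : Continuous g) (hpos : ∀ t, 0 < t → t < α → 0 < g t) :
    StrictMonoOn (pucciPotential lam Lam g) (Icc 0 α) := by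
  refine strictMonoOn_of_deriv_pos (convex_Icc 0 α) (continuous_pucciPotential hg).continuousOn
    fun t ht => ?_
  rw [interior_Icc] at ht
  rw [(hasDerivAt_pucciPotential hg t).deriv, pucciForce_of_nonneg h0 h (hpos t ht.1 ht.2).le]
  exact div_pos (hpos t ht.1 ht.2) (h0.trans_le h)

theorem pucciPotential_le_neg {lam Lam : ℝ} (h0 : 0 < lam) (h : lam ≤ Lam) {g : ℝ → ℝ}
    (hg : Continuous g) (hodd : ∀ t, g (-t) = -g t) {t : ℝ} (ht : 0 ≤ t) :
    pucciPotential lam Lam g t ≤ pucciPotential lam Lam g (-t) := by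
  have hd : ∀ s, HasDerivAt
      (fun s => pucciPotential lam Lam g (-s) - pucciPotential lam Lam g s)
      (pucciForce lam Lam g (-s) * (-1) - pucciForce lam Lam g s) s := fun s =>
    ((hasDerivAt_pucciPotential hg (-s)).comp s (hasDerivAt_neg s)).sub
      (hasDerivAt_pucciPotential hg s)
  have hmono : Monotone fun s => pucciPotential lam Lam g (-s) - pucciPotential lam Lam g s := by
    refine monotone_of_deriv_nonneg (fun s => (hd s).differentiableAt) fun s => ?_
    rw [(hd s).deriv]
    have hL : Lam⁻¹ ≤ lam⁻¹ := inv_anti₀ h0 h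
    rcases le_total 0 (g s) with hs | hs
    · rw [pucciForce_of_nonneg h0 h hs, pucciForce_of_nonpos h0 h (by rw [hodd]; linarith), hodd]
      simp only [div_eq_mul_inv]; nlinarith
    · rw [pucciForce_of_nonpos h0 h hs, pucciForce_of_nonneg h0 h (by rw [hodd]; linarith), hodd]
      simp only [div_eq_mul_inv]; nlinarith
  have := hmono ht
  simp only [neg_zero, sub_self] at this
  linarith

/-- Quadratic bounds on `g` pass to the potential. -/
theorem pucciPotential_bounds {lam Lam ξ m L : ℝ} (h0 : 0 < lam) (h : lam ≤ Lam) {g : ℝ → ℝ}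
    (hg : Continuous g) (hm : 0 < m) (hL : 0 < L)
    (hmL : ∀ t ∈ Icc (-ξ) ξ, m * t ^ 2 ≤ t * g t ∧ t * g t ≤ L * t ^ 2) :
    ∀ t ∈ Icc (-ξ) ξ, m / (2 * Lam) * t ^ 2 ≤ pucciPotential lam Lam g t ∧
      pucciPotential lam Lam g t ≤ L / (2 * lam) * t ^ 2 := by
  have hLam : 0 < Lam := h0.trans_le h
  have hforce : ∀ t ∈ Icc (-ξ) ξ, m / Lam * t ^ 2 ≤ t * pucciForce lam Lam g t ∧
      t * pucciForce lam Lam g t ≤ L / lam * t ^ 2 := by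
    intro t ht
    obtain ⟨h1, h2⟩ := hmL t ht
    have hge : 0 ≤ t * g t := le_trans (by positivity) h1
    have e1 : m / Lam * t ^ 2 ≤ (t * g t) / Lam := by
      rw [div_mul_eq_mul_div]; gcongr
    have e2 : (t * g t) / lam ≤ L / lam * t ^ 2 := by
      rw [div_mul_eq_mul_div]; gcongr
    have e3 : (t * g t) / Lam ≤ (t * g t) / lam := by gcongr
    unfold pucciForce
    rcases min_choice (g t / Lam) (g t / lam) with hc | hc <;> rw [hc, mul_div_assoc'] <;>
      constructor <;> linarith
  have hq : ∀ c t : ℝ, HasDerivAt (fun t : ℝ => c / 2 * t ^ 2) (c * t) t := fun c t =>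
    ((hasDerivAt_pow 2 t).const_mul (c / 2)).congr_deriv (by simp; ring)
  intro t ht
  constructor
  · have := le_of_mul_deriv_nonneg (ξ := ξ)
      (fun s => (hasDerivAt_pucciPotential (lam := lam) (Lam := Lam) hg s).sub (hq (m / Lam) s))
      (fun s hs => by have := (hforce s hs).1; nlinarith) ht
    simp only [Pi.sub_apply, pucciPotential_zero] at this
    have e : m / (2 * Lam) = m / Lam / 2 := by field_simp
    rw [e]; linarith
  · have := le_of_mul_deriv_nonneg (ξ := ξ)
      (fun s => (hq (L / lam) s).sub (hasDerivAt_pucciPotential (lam := lam) (Lam := Lam) hg s))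
      (fun s hs => by have := (hforce s hs).2; nlinarith) ht
    simp only [Pi.sub_apply, pucciPotential_zero] at this
    have e : L / (2 * lam) = L / lam / 2 := by field_simp
    rw [e]; linarith

section Energy

variable {R : EReal} {u g : ℝ → ℝ} {lam Lam k : ℝ}

theorem hasDerivAt_pucciEnergy (hg : Continuous g) (hu : ContDiffOn ℝ 2 u (radialDomain R)) {r : ℝ}
    (hr : r ∈ radialInterior R) :
    HasDerivAt (fun r => deriv u r ^ 2 / 2 + pucciPotential lam Lam g (u r))
      (deriv u r * (deriv (deriv u) r + pucciForce lam Lam g (u r))) r := by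
  have h1 := ((hasDerivAt_deriv_of_mem_radialInterior hu hr).pow 2).div_const 2
  have h2 := (hasDerivAt_pucciPotential (lam := lam) (Lam := Lam) hg (u r)).comp r
    (hasDerivAt_of_mem_radialInterior hu hr)
  exact (h1.add h2).congr_deriv (by simp; ring)

theorem antitoneOn_pucciEnergy (h0 : 0 < lam) (h : lam ≤ Lam) (hk : 0 ≤ k) (hg : Continuous g)
    (hu : ContDiffOn ℝ 2 u (radialDomain R))
    (hode : ∀ r ∈ radialInterior R, PucciRadialEq lam Lam k g u r) :
    AntitoneOn (fun r => deriv u r ^ 2 / 2 + pucciPotential lam Lam g (u r))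
      (radialInterior R) := by
  refine antitoneOn_of_deriv_nonpos (ordConnected_radialInterior R).convex
    (fun r hr => (hasDerivAt_pucciEnergy hg hu hr).continuousAt.continuousWithinAt)
    (fun r hr => (hasDerivAt_pucciEnergy hg hu
      (interior_subset hr)).differentiableAt.differentiableWithinAt) fun r hr => ?_
  have hr := interior_subset hr
  rw [(hasDerivAt_pucciEnergy hg hu hr).deriv]
  refine (pucci_dissipation h0 h (div_nonneg hk hr.1.le) (hode r hr)).trans ?_
  have := hr.1
  have hL := h0.trans_le h
  rw [neg_mul, neg_nonpos]
  positivity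

theorem pucciEnergy_le (h0 : 0 < lam) (h : lam ≤ Lam) (hk : 0 < k) (hg : Continuous g)
    (hR : 0 < R) (hu : ContDiffOn ℝ 2 u (radialDomain R))
    (hode : ∀ r ∈ radialInterior R, PucciRadialEq lam Lam k g u r) {r : ℝ}
    (hr : r ∈ radialInterior R) :
    deriv u r ^ 2 / 2 + pucciPotential lam Lam g (u r) ≤ pucciPotential lam Lam g (u 0) := by
  have hlim : Tendsto (fun r => deriv u r ^ 2 / 2 + pucciPotential lam Lam g (u r)) (𝓝[>] 0)
      (𝓝 (0 ^ 2 / 2 + pucciPotential lam Lam g (u 0))) :=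
    (((tendsto_deriv_nhdsGT_zero h0 h hk hg hR hu hode).pow 2).div_const 2).add
      (((continuous_pucciPotential hg).tendsto _).comp (tendsto_nhdsGT_zero hR hu))
  rw [show (0 : ℝ) ^ 2 / 2 + pucciPotential lam Lam g (u 0) = pucciPotential lam Lam g (u 0) by
    ring] at hlim
  refine ge_of_tendsto hlim ?_
  filter_upwards [eventually_mem_radialInterior hR,
    (gt_mem_nhds hr.1).filter_mono nhdsWithin_le_nhds] with s hs hsr
  exact antitoneOn_pucciEnergy h0 h hk.le hg hu hode hs hr (le_of_lt hsr)

/-- The energy confines the solution to the band determined by its initial value. -/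
theorem mem_Icc_of_pucciRadialEq {α : ℝ} (h0 : 0 < lam) (h : lam ≤ Lam) (hk : 0 < k)
    (hg : Continuous g) (hodd : ∀ t, g (-t) = -g t) (hpos : ∀ t, 0 < t → t < α → 0 < g t)
    (hR : 0 < R) (hu : ContDiffOn ℝ 2 u (radialDomain R))
    (hode : ∀ r ∈ radialInterior R, PucciRadialEq lam Lam k g u r)
    (hu0 : 0 < u 0) (huα : u 0 < α) {r : ℝ} (hr : r ∈ radialDomain R) :
    u r ∈ Icc (-u 0) (u 0) := by
  have hmono := strictMonoOn_pucciPotential h0 h hg hpos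
  have hconn : IsPreconnected (u '' radialDomain R) :=
    (ordConnected_radialDomain R).isPreconnected.image u hu.continuousOn
  have hord := hconn.ordConnected
  have hz : u 0 ∈ u '' radialDomain R := mem_image_of_mem u (zero_mem_radialDomain hR)
  have hle : ∀ y ∈ u '' radialDomain R,
      pucciPotential lam Lam g y ≤ pucciPotential lam Lam g (u 0) := by
    rintro _ ⟨s, hs, rfl⟩
    rcases hs.1.eq_or_lt with rfl | hs0
    · exact le_rfl
    · have := pucciEnergy_le h0 h hk hg hR hu hode ⟨hs0, hs.2⟩
      nlinarith [sq_nonneg (deriv u s)]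
  constructor
  · by_contra! hlt
    obtain ⟨y, hy1, hy2⟩ := exists_between (max_lt hlt (neg_lt_neg huα))
    have hy := hord.out (mem_image_of_mem u hr) hz
      ⟨((le_max_left _ _).trans_lt hy1).le, by linarith⟩
    have h1 := hle y hy
    have hyα : -α < y := (le_max_right _ _).trans_lt hy1
    have h2 := hmono ⟨hu0.le, huα.le⟩ ⟨by linarith, by linarith⟩ (show u 0 < -y by linarith)
    have h3 := pucciPotential_le_neg h0 h hg hodd (show 0 ≤ -y by linarith)
    rw [neg_neg] at h3
    linarith
  · by_contra! hlt
    obtain ⟨y, hy1, hy2⟩ := exists_between (lt_min hlt huα)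
    have hy := hord.out hz (mem_image_of_mem u hr) ⟨hy1.le, (hy2.trans_le (min_le_left _ _)).le⟩
    have hyα := hy2.trans_le (min_le_right _ _)
    have h2 := hmono ⟨hu0.le, huα.le⟩ ⟨by linarith, hyα.le⟩ hy1
    linarith [hle y hy]

end Energy

/-- A field that is Lipschitz in space, uniformly in time, has local integral curves whose
lifetime depends only on a bound for the initial value. -/
theorem exists_uniform_lifetime {E : Type*} [NormedAddCommGroup E] [NormedSpace ℝ E]
    [CompleteSpace E] {F : ℝ → E → E} {K : NNReal} (hF : ∀ t, LipschitzWith K (F t))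
    (hc : ∀ x, Continuous (F · x)) {c : ℝ} (h0 : ∀ t, ‖F t 0‖ ≤ c) (B : ℝ) :
    ∃ η > 0, ∀ (t₀ : ℝ) (x₀ : E), ‖x₀‖ ≤ B → ∃ y : ℝ → E, y t₀ = x₀ ∧
      ∀ t ∈ Ioo (t₀ - η) (t₀ + η), HasDerivAt y (F t (y t)) t := by
  set L : NNReal := Real.toNNReal (K * (B + 1) + c)
  have hη : (0 : ℝ) < 1 / (L + 1) := by positivity
  set η : ℝ := 1 / (L + 1) with hη_def
  refine ⟨η, hη, fun t₀ x₀ hx₀ => ?_⟩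
  have hpl : IsPicardLindelof F (tmin := t₀ - η) (tmax := t₀ + η)
      ⟨t₀, by linarith, by linarith⟩ x₀ 1 0 L K :=
    { lipschitzOnWith := fun t _ => (hF t).lipschitzOnWith
      continuousOn := fun x _ => (hc x).continuousOn
      norm_le := by
        intro t _ x hx
        have h1 : ‖F t x - F t 0‖ ≤ K * ‖x - 0‖ := (hF t).norm_sub_le x 0
        have h2 : ‖x‖ ≤ B + 1 := by
          rw [mem_closedBall_iff_norm, NNReal.coe_one] at hx
          linarith [norm_le_norm_add_norm_sub' x x₀]
        rw [sub_zero] at h1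
        have h3 : (K : ℝ) * ‖x‖ ≤ K * (B + 1) := by gcongr
        refine le_trans ?_ (Real.le_coe_toNNReal _)
        linarith [norm_le_norm_add_norm_sub' (F t x) (F t 0), h0 t]
      mul_max_le := by
        simp only [add_sub_cancel_left, sub_sub_cancel, max_self, NNReal.coe_one, NNReal.coe_zero,
          sub_zero]
        rw [hη_def, mul_one_div, div_le_one (by positivity)]
        linarith }
  obtain ⟨y, hy0, hy⟩ := hpl.exists_eq_forall_mem_Icc_hasDerivWithinAt₀
  exact ⟨y, hy0, fun t ht => (hy t (Ioo_subset_Icc_self ht)).hasDerivAt (Icc_mem_nhds ht.1 ht.2)⟩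

/-- The first-order field of the radial equation, with the singular coefficient frozen below
radius `ρ`. -/
noncomputable def pucciField (lam Lam k ρ : ℝ) (g : ℝ → ℝ) (t : ℝ) (x : ℝ × ℝ) : ℝ × ℝ :=
  (x.2, max ((-(k / max t ρ * min (lam * x.2) (Lam * x.2)) - g x.1) / lam)
    ((-(k / max t ρ * min (lam * x.2) (Lam * x.2)) - g x.1) / Lam))

theorem continuous_pucciField {lam Lam k ρ : ℝ} {g : ℝ → ℝ} (hρ : 0 < ρ) (hg : Continuous g) :
    Continuous fun z : ℝ × ℝ × ℝ => pucciField lam Lam k ρ g z.1 z.2 := by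
  have h : Continuous fun z : ℝ × ℝ × ℝ => k / max z.1 ρ :=
    continuous_const.div (by fun_prop) fun z => (hρ.trans_le (le_max_right _ _)).ne'
  unfold pucciField
  fun_prop

theorem exists_lipschitzWith_pucciField {lam Lam k ρ : ℝ} {g : ℝ → ℝ} (h0 : 0 < lam)
    (h : lam ≤ Lam) (hk : 0 ≤ k) (hρ : 0 < ρ) {Kg : NNReal} (hg : LipschitzWith Kg g) :
    ∃ K, ∀ t, LipschitzWith K (pucciField lam Lam k ρ g t) := by
  have hL : 0 < Lam := h0.trans_le h
  refine ⟨Real.toNNReal (1 + (k / ρ * Lam + Kg) / lam), fun t =>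
    LipschitzWith.of_dist_le_mul fun x y => ?_⟩
  rw [Real.coe_toNNReal _ (by positivity)]
  have d1 : |x.1 - y.1| ≤ dist x y := le_max_left _ _
  have d2 : |x.2 - y.2| ≤ dist x y := le_max_right _ _
  set D := dist x y
  have hD : 0 ≤ D := dist_nonneg
  have hkt : k / max t ρ ≤ k / ρ := by
    gcongr
    exact le_max_right _ _
  have hkt0 : 0 ≤ k / max t ρ := div_nonneg hk (hρ.le.trans (le_max_right _ _))
  have hmin : |min (lam * x.2) (Lam * x.2) - min (lam * y.2) (Lam * y.2)| ≤ Lam * D := by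
    refine (abs_min_sub_min_le_max _ _ _ _).trans (max_le ?_ ?_) <;>
      rw [← mul_sub, abs_mul, abs_of_pos (by assumption)] <;> gcongr
  have hgd : |g x.1 - g y.1| ≤ Kg * D := by
    have := hg.dist_le_mul x.1 y.1
    rw [Real.dist_eq, Real.dist_eq] at this
    exact this.trans (by gcongr)
  have hy : |(-(k / max t ρ * min (lam * x.2) (Lam * x.2)) - g x.1)
      - (-(k / max t ρ * min (lam * y.2) (Lam * y.2)) - g y.1)| ≤ (k / ρ * Lam + Kg) * D := by
    calc _ = |-(k / max t ρ * (min (lam * x.2) (Lam * x.2) - min (lam * y.2) (Lam * y.2)))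
          - (g x.1 - g y.1)| := by congr 1; ring
      _ ≤ k / max t ρ * |min (lam * x.2) (Lam * x.2) - min (lam * y.2) (Lam * y.2)|
          + |g x.1 - g y.1| := by
        refine (abs_sub _ _).trans_eq ?_
        rw [abs_neg, abs_mul, abs_of_nonneg hkt0]
      _ ≤ k / ρ * (Lam * D) + Kg * D := by gcongr
      _ = _ := by ring
  have hq : 0 ≤ (k / ρ * Lam + Kg) / lam * D := by positivity
  refine max_le ?_ ?_
  · change |x.2 - y.2| ≤ _
    nlinarith
  · refine (abs_max_sub_max_le_max _ _ _ _).trans (max_le ?_ ?_)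
    · rw [← sub_div, abs_div, abs_of_pos h0]
      calc _ ≤ (k / ρ * Lam + Kg) * D / lam := div_le_div_of_nonneg_right hy h0.le
        _ ≤ _ := by rw [mul_div_right_comm]; linarith
    · rw [← sub_div, abs_div, abs_of_pos hL]
      calc _ ≤ (k / ρ * Lam + Kg) * D / Lam := div_le_div_of_nonneg_right hy hL.le
        _ ≤ (k / ρ * Lam + Kg) * D / lam := by gcongr
        _ ≤ _ := by rw [mul_div_right_comm]; linarith

set_option maxHeartbeats 1000000 in
/-- A solution on `[0, R)` that stays in a band where `g` is Lipschitz, with bounded derivative,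
extends past `R`. -/
theorem exists_extension_pucciRadialEq {lam Lam k α ξ B R : ℝ} (h0 : 0 < lam) (h : lam ≤ Lam)
    (hk : 0 ≤ k) {g u : ℝ → ℝ} (hg : LocallyLipschitz g) (hR : 0 < R) (hξα : ξ < α)
    (hu : ContDiffOn ℝ 2 u (radialDomain R))
    (hode : ∀ r ∈ radialInterior R, PucciRadialEq lam Lam k g u r)
    (hbd : ∀ r ∈ radialInterior R, |u r| ≤ ξ) (hbd' : ∀ r ∈ radialInterior R, |deriv u r| ≤ B) :
    ∃ (R' : ℝ) (v : ℝ → ℝ), R < R' ∧ ContDiffOn ℝ 2 v (radialDomain R') ∧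
      (∀ r ∈ radialInterior R', PucciRadialEq lam Lam k g v r) ∧ EqOn v u (Iio R) := by
  have hint : ∀ r : ℝ, 0 < r → r < R → r ∈ radialInterior R := fun r h1 h2 =>
    ⟨h1, EReal.coe_lt_coe_iff.2 h2⟩
  obtain ⟨Kg, hKg⟩ := (hg.locallyLipschitzOn (s := Icc (-α) α)).exists_lipschitzOnWith_of_compact
    isCompact_Icc
  obtain ⟨G, hG, hGg⟩ := hKg.extend_real
  set ρ := R / 2 with hρ_def
  have hρ : 0 < ρ := by positivity
  set F := pucciField lam Lam k ρ G with hF_def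
  obtain ⟨K, hK⟩ := exists_lipschitzWith_pucciField h0 h hk hρ hG
  have hFc : Continuous fun z : ℝ × ℝ × ℝ => F z.1 z.2 := continuous_pucciField hρ hG.continuous
  have hF0 : ∀ t, ‖F t 0‖ ≤ ‖F 0 0‖ := fun t => by simp [hF_def, pucciField]
  obtain ⟨η, hη, hex⟩ := exists_uniform_lifetime hK (fun x => hFc.comp (by fun_prop :
    Continuous fun t : ℝ => (t, x))) hF0 (max ξ B)
  set t₀ := max (3 * R / 4) (R - η / 2)
  have ht1 : ρ < t₀ := lt_of_lt_of_le (by linarith) (le_max_left _ _)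
  have ht2 : t₀ < R := max_lt (by linarith) (by linarith)
  have ht3 : R < t₀ + η := by linarith [le_max_right (3 * R / 4) (R - η / 2)]
  have ht₀ := hint t₀ (hρ.trans ht1) ht2
  obtain ⟨y, hy0, hy⟩ := hex t₀ (u t₀, deriv u t₀)
    (max_le_max (hbd t₀ ht₀) (hbd' t₀ ht₀))
  set a := max ρ (t₀ - η)
  have haR : a < R := max_lt (by linarith) (by linarith)
  have hat : a < t₀ := max_lt ht1 (by linarith)
  have hρa : ρ ≤ a := le_max_left _ _
  have hGeq : ∀ p, |p| < α → G p = g p := fun p hp =>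
    (hGg ⟨(abs_lt.1 hp).1.le, (abs_lt.1 hp).2.le⟩).symm
  have hmaxρ : ∀ t, a < t → max t ρ = t := fun t ht => max_eq_left (hρa.trans ht.le)
  have hux : ∀ t ∈ Ioo a R, HasDerivAt (fun t => (u t, deriv u t)) (F t (u t, deriv u t)) t := by
    intro t ht
    have htI := hint t (by linarith [ht.1]) ht.2
    have e : deriv (deriv u) t = (F t (u t, deriv u t)).2 := by
      have := hode t htI
      rw [PucciRadialEq, pucciCoef_mul_self h (deriv u t)] at this
      simp only [hF_def, pucciField, hmaxρ t ht.1, hGeq _ ((hbd t htI).trans_lt hξα)]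
      rw [← pucciCoef_mul_eq_iff h0 h]
      linarith
    have := (hasDerivAt_of_mem_radialInterior hu htI).prodMk
      (hasDerivAt_deriv_of_mem_radialInterior hu htI)
    rw [e] at this
    exact this
  have heq : EqOn (fun t => (u t, deriv u t)) y (Ioo a R) :=
    ODE_solution_unique_of_mem_Ioo (v := F) (s := fun _ => univ) (t₀ := t₀)
      (fun t _ => (hK t).lipschitzOnWith) ⟨hat, ht2⟩ (fun t ht => ⟨hux t ht, mem_univ _⟩)
      (fun t ht => ⟨hy t ⟨(le_max_right _ _).trans_lt ht.1, ht.2.trans ht3⟩, mem_univ _⟩) hy0.symm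
  have hyc : ContinuousAt (fun t => |(y t).1|) R :=
    (hy R ⟨by linarith, ht3⟩).continuousAt.fst.abs
  have hyR : |(y R).1| ≤ ξ := by
    refine le_of_tendsto (hyc.tendsto.mono_left (nhdsWithin_le_nhds (s := Iio R))) ?_
    filter_upwards [Ioo_mem_nhdsLT haR] with t ht
    rw [← heq ht]
    exact hbd t (hint t (by linarith [ht.1]) ht.2)
  obtain ⟨l, b', hRb, hb⟩ := mem_nhds_iff_exists_Ioo_subset.1
    (hyc.eventually (gt_mem_nhds (hyR.trans_lt hξα)))
  set b := min b' (t₀ + η)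
  have hRb' : R < b := lt_min hRb.2 ht3
  have hyI : ∀ t ∈ Ioo a b, HasDerivAt y (F t (y t)) t := fun t ht =>
    hy t ⟨(le_max_right _ _).trans_lt ht.1, ht.2.trans_le (min_le_right _ _)⟩
  have hyα : ∀ t ∈ Ioo a b, |(y t).1| < α := by
    intro t ht
    rcases lt_or_ge t R with htR | htR
    · rw [← heq ⟨ht.1, htR⟩]
      exact (hbd t (hint t (by linarith [ht.1]) htR)).trans_lt hξα
    · exact hb ⟨hRb.1.trans_le htR, ht.2.trans_le (min_le_left _ _)⟩
  set v : ℝ → ℝ := fun r => if r < R then u r else (y r).1 with hv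
  have hvu : EqOn v u (Iio R) := fun r hr => if_pos hr
  have hvy : EqOn v (fun r => (y r).1) (Ioo a b) := by
    intro t ht
    by_cases htR : t < R
    · rw [hvu htR]
      exact congrArg Prod.fst (heq ⟨ht.1, htR⟩)
    · exact if_neg htR
  have hd1 : ∀ t ∈ Ioo a b, HasDerivAt v (y t).2 t := fun t ht =>
    HasDerivAt.congr_of_eventuallyEq (hyI t ht).fst
      (Filter.eventuallyEq_of_mem (isOpen_Ioo.mem_nhds ht) hvy)
  have hd1' : EqOn (deriv v) (fun r => (y r).2) (Ioo a b) := fun t ht => (hd1 t ht).deriv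
  have hd2 : ∀ t ∈ Ioo a b, HasDerivAt (deriv v) (F t (y t)).2 t := fun t ht =>
    HasDerivAt.congr_of_eventuallyEq (hyI t ht).snd
      (Filter.eventuallyEq_of_mem (isOpen_Ioo.mem_nhds ht) hd1')
  have hvC : ContDiffOn ℝ 2 v (Ioo a b) := by
    rw [show (2 : WithTop ℕ∞) = 1 + 1 by norm_num, contDiffOn_succ_iff_deriv_of_isOpen isOpen_Ioo]
    refine ⟨fun t ht => (hd1 t ht).differentiableAt.differentiableWithinAt, by simp, ?_⟩
    rw [show (1 : WithTop ℕ∞) = 0 + 1 by norm_num, contDiffOn_succ_iff_deriv_of_isOpen isOpen_Ioo]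
    refine ⟨fun t ht => (hd2 t ht).differentiableAt.differentiableWithinAt, by simp, ?_⟩
    rw [contDiffOn_zero]
    have hyc' : ContinuousOn (fun t => (t, y t)) (Ioo a b) :=
      continuousOn_id.prodMk fun t ht => (hyI t ht).continuousAt.continuousWithinAt
    have : ContinuousOn (fun t => (F t (y t)).2) (Ioo a b) := hFc.snd.comp_continuousOn hyc'
    exact this.congr fun t ht => (hd2 t ht).deriv
  refine ⟨b, v, hRb', ?_, ?_, hvu⟩
  · rintro r ⟨hr0, hrb⟩
    rw [EReal.coe_lt_coe_iff] at hrb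
    rcases lt_or_ge r R with hrR | hrR
    · have hmem : radialDomain R ∈ 𝓝[radialDomain b] r := by
        filter_upwards [self_mem_nhdsWithin, (gt_mem_nhds hrR).filter_mono nhdsWithin_le_nhds]
          with s hs hsR
        exact ⟨hs.1, EReal.coe_lt_coe_iff.2 hsR⟩
      refine ((hu r ⟨hr0, EReal.coe_lt_coe_iff.2 hrR⟩).mono_of_mem_nhdsWithin
        hmem).congr_of_eventuallyEq ?_ (hvu hrR)
      filter_upwards [(gt_mem_nhds hrR).filter_mono nhdsWithin_le_nhds] with s hs using hvu hs
    · have hr : r ∈ Ioo a b := ⟨haR.trans_le hrR, hrb⟩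
      exact ((hvC r hr).contDiffAt (isOpen_Ioo.mem_nhds hr)).contDiffWithinAt
  · rintro r ⟨hr0, hrb⟩
    rw [EReal.coe_lt_coe_iff] at hrb
    rcases lt_or_ge r R with hrR | hrR
    · have he : v =ᶠ[𝓝 r] u := Filter.eventuallyEq_of_mem (Iio_mem_nhds hrR) hvu
      have := hode r (hint r hr0 hrR)
      unfold PucciRadialEq at this ⊢
      rwa [he.deriv.deriv_eq, he.deriv_eq, he.eq_of_nhds]
    · have hr : r ∈ Ioo a b := ⟨haR.trans_le hrR, hrb⟩
      unfold PucciRadialEq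
      rw [pucciCoef_mul_self h (deriv v r), (pucciCoef_mul_eq_iff h0 h _
        (-(k / r * min (lam * (y r).2) (Lam * (y r).2)) - G (y r).1)).2, hd1' hr, hvy hr,
        hGeq _ (hyα r hr)]
      · ring
      · rw [(hd2 r hr).deriv, hF_def, pucciField, hmaxρ r hr.1]

/-- A nonnegative function with `W' ≤ -θ W / r` decays to zero. -/
theorem tendsto_zero_of_deriv_le_neg_div {W W' : ℝ → ℝ} {θ r₀ : ℝ} (hθ : 0 < θ) (hr₀ : 0 < r₀)
    (hW : ∀ r ≥ r₀, HasDerivAt W (W' r) r) (hW0 : ∀ r ≥ r₀, 0 ≤ W r)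
    (hle : ∀ r ≥ r₀, W' r ≤ -(θ * W r / r)) : Tendsto W atTop (𝓝 0) := by
  have hd : ∀ r ≥ r₀, HasDerivAt (fun r => W r * r ^ θ)
      (W' r * r ^ θ + W r * (θ * r ^ (θ - 1))) r := fun r hr =>
    (hW r hr).mul (Real.hasDerivAt_rpow_const (Or.inl (hr₀.trans_le hr).ne'))
  have hanti : AntitoneOn (fun r => W r * r ^ θ) (Ici r₀) := by
    refine antitoneOn_of_deriv_nonpos (convex_Ici r₀)
      (fun r hr => (hd r hr).continuousAt.continuousWithinAt)
      (fun r hr => (hd r (interior_subset hr)).differentiableAt.differentiableWithinAt)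
      fun r hr => ?_
    have hr : r₀ ≤ r := interior_subset hr
    have hr0 : 0 < r := hr₀.trans_le hr
    rw [(hd r hr).deriv, Real.rpow_sub_one hr0.ne']
    have hp : 0 < r ^ θ := Real.rpow_pos_of_pos hr0 θ
    calc W' r * r ^ θ + W r * (θ * (r ^ θ / r))
        ≤ -(θ * W r / r) * r ^ θ + W r * (θ * (r ^ θ / r)) := by
          gcongr
          exact hle r hr
      _ = 0 := by ring
  have hlim : Tendsto (fun r : ℝ => W r₀ * r₀ ^ θ * r ^ (-θ)) atTop (𝓝 0) := by
    simpa using (tendsto_rpow_neg_atTop hθ).const_mul (W r₀ * r₀ ^ θ)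
  refine squeeze_zero' ?_ ?_ hlim
  · filter_upwards [eventually_ge_atTop r₀] with r hr using hW0 r hr
  · filter_upwards [eventually_ge_atTop r₀] with r hr
    have hr0 : 0 < r := hr₀.trans_le hr
    rw [Real.rpow_neg hr0.le, ← div_eq_mul_inv, le_div_iff₀ (Real.rpow_pos_of_pos hr0 θ)]
    exact hanti self_mem_Ici hr hr

/-- Pointwise estimates showing that `p² / 2 + P + ε t p / r` is a strict Lyapunov function. -/
theorem pucci_lyapunov_bounds {p t a f P r c μ L : ℝ} (hr : 0 < r) (hc : 0 < c) (hμ : 0 < μ)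
    (hL : 0 < L) (hr1 : 1 ≤ 2 * min (1 / 4) (μ / 2) * r) (hr2 : c ≤ 4 * min (1 / 4) (μ / 2) * r)
    (hdiss : p * (a + f) ≤ -(c / r) * p ^ 2) (hta : t * a ≤ p ^ 2 / 2 - μ * t ^ 2)
    (hP1 : μ * t ^ 2 ≤ P) (hP2 : P ≤ L * t ^ 2) :
    min (1 / 4) (μ / 2) * (p ^ 2 + t ^ 2) ≤ p ^ 2 / 2 + P + c / 2 * (t * p / r) ∧
    p * (a + f) + c / 2 * (((p * p + t * a) * r - t * p * 1) / r ^ 2) ≤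
      -(min (c / 8) (c * μ / 4) / (1 + L) * (p ^ 2 / 2 + P + c / 2 * (t * p / r)) / r) := by
  set q := p ^ 2 + t ^ 2 with hq
  have hq0 : 0 ≤ q := by positivity
  have htp : |t * p| ≤ q / 2 := abs_le.2
    ⟨by nlinarith [sq_nonneg (t + p)], by nlinarith [sq_nonneg (t - p)]⟩
  set x := t * p / r with hx
  have hxr : x * r = t * p := div_mul_cancel₀ _ hr.ne'
  have hxabs : |x| * r ≤ q / 2 := by
    rw [← abs_of_pos hr, ← abs_mul, hxr]
    exact htp
  set β := min (1 / 4) (μ / 2)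
  have hβ0 : 0 < β := lt_min (by norm_num) (by positivity)
  have hm1 : β ≤ 1 / 4 := min_le_left _ _
  have hm2 : β ≤ μ / 2 := min_le_right _ _
  have hβq : β * q ≤ p ^ 2 / 4 + μ / 2 * t ^ 2 := by
    have h1 := mul_le_mul_of_nonneg_right hm1 (sq_nonneg p)
    have h2 := mul_le_mul_of_nonneg_right hm2 (sq_nonneg t)
    rw [hq, mul_add]
    linarith
  have hx1 : |x| ≤ β * q := by
    have : |x| * r ≤ β * q * r := by
      have := mul_le_mul_of_nonneg_right hr1 hq0
      linarith
    exact le_of_mul_le_mul_right this hr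
  have hx2 : c / 2 * |x| ≤ β * q := by
    have : c / 2 * |x| ≤ 4 * β * r / 2 * |x| := by gcongr
    have := mul_le_mul_of_nonneg_left hxabs hβ0.le
    linarith
  have hx3 : |c / 2 * x| ≤ β * q := by rwa [abs_mul, abs_of_pos (by positivity : 0 < c / 2)]
  have hx4 := abs_le.1 hx3
  have hx5 : -|x| ≤ x := neg_abs_le x
  set κ := min (c / 8) (c * μ / 4)
  have hκ0 : 0 < κ := lt_min (by positivity) (by positivity)
  have hκ1 : κ ≤ c / 8 := min_le_left _ _
  have hκ2 : κ ≤ c * μ / 4 := min_le_right _ _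
  have hlow : β * q ≤ p ^ 2 / 2 + P + c / 2 * x := by linarith [hx4.1]
  refine ⟨hlow, ?_⟩
  have hup : p ^ 2 / 2 + P + c / 2 * x ≤ (1 + L) * q := by
    have h1 := mul_le_mul_of_nonneg_right hm1 hq0
    have h2 : 0 ≤ L * p ^ 2 := by positivity
    have h3 := sq_nonneg t
    rw [one_add_mul, hq, mul_add]
    rw [hq] at h1 hx4
    linarith [hx4.2]
  have hdown : p * (a + f) + c / 2 * (((p * p + t * a) * r - t * p * 1) / r ^ 2) ≤
      -(κ * q / r) := by
    have e1 : ((p * p + t * a) * r - t * p * 1) / r ^ 2 = (p * p + t * a - x) / r := by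
      rw [hx]; field_simp
    have e2 : p * p + t * a - x ≤ 7 / 4 * p ^ 2 - μ / 2 * t ^ 2 := by linarith
    rw [e1]
    calc _ ≤ -(c / r) * p ^ 2 + c / 2 * ((7 / 4 * p ^ 2 - μ / 2 * t ^ 2) / r) := by
          gcongr
      _ = (-(c / 8 * p ^ 2 + c * μ / 4 * t ^ 2)) / r := by ring
      _ ≤ (-(κ * q)) / r := by
          refine div_le_div_of_nonneg_right ?_ hr.le
          have h1 := mul_le_mul_of_nonneg_right hκ1 (sq_nonneg p)
          have h2 := mul_le_mul_of_nonneg_right hκ2 (sq_nonneg t)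
          rw [hq, mul_add]
          linarith
      _ = _ := by ring
  refine hdown.trans (neg_le_neg (div_le_div_of_nonneg_right ?_ hr.le))
  rw [div_mul_eq_mul_div, div_le_iff₀ (by positivity)]
  linarith [mul_le_mul_of_nonneg_left hup hκ0.le]

section Asymptotics

variable {u g : ℝ → ℝ} {lam Lam k ξ m L : ℝ}

theorem mem_radialInterior_top {r : ℝ} (hr : 0 < r) : r ∈ radialInterior ⊤ :=
  ⟨hr, EReal.coe_lt_top r⟩

theorem eventually_friction_small (hm : 0 < m) (h0 : 0 < lam) :
    ∀ᶠ r : ℝ in atTop, (k / r * Lam) ^ 2 ≤ lam * m := by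
  have h1 : Tendsto (fun r : ℝ => (k / r * Lam) ^ 2) atTop (𝓝 ((0 * Lam) ^ 2)) :=
    ((tendsto_const_nhds.div_atTop tendsto_id).mul_const Lam).pow 2
  exact (h1.eventually (gt_mem_nhds (by simp; positivity))).mono fun _ h => le_of_lt h

theorem tendsto_sq_add_sq_zero (h0 : 0 < lam) (h : lam ≤ Lam) (hk : 0 < k) (hg : Continuous g)
    (hm : 0 < m) (hL : 0 < L)
    (hmL : ∀ t ∈ Icc (-ξ) ξ, m * t ^ 2 ≤ t * g t ∧ t * g t ≤ L * t ^ 2)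
    (hu : ContDiffOn ℝ 2 u (radialDomain ⊤))
    (hode : ∀ r ∈ radialInterior ⊤, PucciRadialEq lam Lam k g u r)
    (hbd : ∀ r > 0, u r ∈ Icc (-ξ) ξ) :
    Tendsto (fun r => deriv u r ^ 2 + u r ^ 2) atTop (𝓝 0) := by
  have hLam : 0 < Lam := h0.trans_le h
  set μ := m / (2 * Lam)
  have hμ : 0 < μ := by positivity
  set β := min (1 / 4) (μ / 2)
  have hβ : 0 < β := lt_min (by norm_num) (by positivity)
  set c := lam / Lam * k with hc_def
  have hc : 0 < c := by positivity
  obtain ⟨r₀, hr₀⟩ := eventually_atTop.1 ((eventually_gt_atTop (0 : ℝ)).and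
    ((eventually_friction_small (k := k) (Lam := Lam) hm h0).and
      ((eventually_ge_atTop (1 / (2 * β))).and (eventually_ge_atTop (c / (4 * β))))))
  have key : ∀ r ≥ r₀, _ := fun r hr => by
    obtain ⟨hr0, hr1, hr2, hr3⟩ := hr₀ r hr
    rw [div_le_iff₀' (by positivity)] at hr2 hr3
    have hP := pucciPotential_bounds h0 h hg hm hL hmL (u r) (hbd r hr0)
    have heq := hode r (mem_radialInterior_top hr0)
    have hd := pucci_dissipation h0 h (div_nonneg hk.le hr0.le) heq
    rw [mul_div_assoc', ← hc_def] at hd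
    exact pucci_lyapunov_bounds hr0 hc hμ (by positivity : 0 < L / (2 * lam)) hr2 hr3 hd
      (pucci_mul_second_le h0 h (div_nonneg hk.le hr0.le) hr1 hm (hmL _ (hbd r hr0)).1 heq)
      hP.1 hP.2
  have hpos : 0 < r₀ := (hr₀ r₀ le_rfl).1
  have hW : ∀ r ≥ r₀, HasDerivAt
      (fun r => deriv u r ^ 2 / 2 + pucciPotential lam Lam g (u r) + c / 2 * (u r * deriv u r / r))
      (deriv u r * (deriv (deriv u) r + pucciForce lam Lam g (u r)) + c / 2 *
        (((deriv u r * deriv u r + u r * deriv (deriv u) r) * r - u r * deriv u r * 1) / r ^ 2))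
      r := fun r hr => by
    have hrI := mem_radialInterior_top (hpos.trans_le hr)
    exact (hasDerivAt_pucciEnergy hg hu hrI).add
      ((((hasDerivAt_of_mem_radialInterior hu hrI).mul
        (hasDerivAt_deriv_of_mem_radialInterior hu hrI)).div (hasDerivAt_id r)
          (hpos.trans_le hr).ne').const_mul _)
  have hlim := tendsto_zero_of_deriv_le_neg_div (by positivity :
      0 < min (c / 8) (c * μ / 4) / (1 + L / (2 * lam))) hpos hW
    (fun r hr => le_trans (by positivity) (key r hr).1) (fun r hr => (key r hr).2)
  have hlim' := hlim.const_mul (1 / β)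
  rw [mul_zero] at hlim'
  refine squeeze_zero' (Eventually.of_forall fun r => by positivity) ?_ hlim'
  filter_upwards [eventually_ge_atTop r₀] with r hr
  rw [one_div_mul_eq_div, le_div_iff₀' hβ]
  exact (key r hr).1

theorem exists_zero_ge (h0 : 0 < lam) (h : lam ≤ Lam) (hk : 0 < k)
    (hm : 0 < m) (hmg : ∀ t ∈ Icc (-ξ) ξ, m * t ^ 2 ≤ t * g t)
    (hu : ContDiffOn ℝ 2 u (radialDomain ⊤))
    (hode : ∀ r ∈ radialInterior ⊤, PucciRadialEq lam Lam k g u r)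
    (hbd : ∀ r > 0, u r ∈ Icc (-ξ) ξ) (M : ℝ) : ∃ r, M ≤ r ∧ u r = 0 := by
  by_contra! hne
  have hLam : 0 < Lam := h0.trans_le h
  set μ := m / (2 * Lam)
  have hμ : 0 < μ := by positivity
  set s := √(2 * μ)
  have hs : 0 < s := Real.sqrt_pos.2 (by positivity)
  have hs2 : s ^ 2 = 2 * μ := Real.sq_sqrt (by positivity)
  obtain ⟨r₀, hr₀⟩ := eventually_atTop.1 ((eventually_gt_atTop (0 : ℝ)).and
    ((eventually_friction_small (k := k) (Lam := Lam) hm h0).and (eventually_ge_atTop M)))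
  have hd : ∀ r ≥ r₀, HasDerivAt (fun r => Real.arctan (deriv u r / u r / s) + s / 2 * r)
      (1 / (1 + (deriv u r / u r / s) ^ 2) *
        ((deriv (deriv u) r * u r - deriv u r * deriv u r) / u r ^ 2 / s) + s / 2 * 1) r := by
    intro r hr
    have hrI := mem_radialInterior_top (hr₀ r hr).1
    exact ((((hasDerivAt_deriv_of_mem_radialInterior hu hrI).div
      (hasDerivAt_of_mem_radialInterior hu hrI) (hne r (hr₀ r hr).2.2)).div_const s).arctan).add
      ((hasDerivAt_id r).const_mul _)
  have hanti : AntitoneOn (fun r => Real.arctan (deriv u r / u r / s) + s / 2 * r) (Ici r₀) := by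
    refine antitoneOn_of_deriv_nonpos (convex_Ici r₀)
      (fun r hr => (hd r hr).continuousAt.continuousWithinAt)
      (fun r hr => (hd r (interior_subset hr)).differentiableAt.differentiableWithinAt)
      fun r hr => ?_
    have hr : r₀ ≤ r := interior_subset hr
    obtain ⟨hr0, hr1, hr2⟩ := hr₀ r hr
    rw [(hd r hr).deriv]
    have hu0 : u r ≠ 0 := hne r hr2
    have hsec := pucci_mul_second_le h0 h (div_nonneg hk.le hr0.le) hr1 hm
      (hmg _ (hbd r hr0)) (hode r (mem_radialInterior_top hr0))
    change u r * _ ≤ _ - μ * _ at hsec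
    have hnum : deriv (deriv u) r * u r - deriv u r * deriv u r ≤
        -((deriv u r ^ 2 + s ^ 2 * u r ^ 2) / 2) := by rw [hs2]; linarith
    have hD : 0 < deriv u r ^ 2 + s ^ 2 * u r ^ 2 := by positivity
    have e : 1 / (1 + (deriv u r / u r / s) ^ 2) *
        ((deriv (deriv u) r * u r - deriv u r * deriv u r) / u r ^ 2 / s) =
        s * (deriv (deriv u) r * u r - deriv u r * deriv u r) /
          (deriv u r ^ 2 + s ^ 2 * u r ^ 2) := by
      have : 1 + (deriv u r / u r / s) ^ 2 =
          (deriv u r ^ 2 + s ^ 2 * u r ^ 2) / (s ^ 2 * u r ^ 2) := by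
        field_simp; ring
      rw [this]
      field_simp
    have hle : s * (deriv (deriv u) r * u r - deriv u r * deriv u r) /
          (deriv u r ^ 2 + s ^ 2 * u r ^ 2) ≤ -(s / 2) := by
      rw [div_le_iff₀ hD]
      nlinarith
    rw [e]
    linarith
  obtain ⟨r, hr, hrbig⟩ := ((eventually_ge_atTop r₀).and (((tendsto_id (x := atTop)).const_mul_atTop
    (by positivity : 0 < s / 2)).eventually_gt_atTop
      (Real.arctan (deriv u r₀ / u r₀ / s) + s / 2 * r₀ + Real.pi / 2))).exists
  have h1 := hanti self_mem_Ici hr hr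
  have h2 := Real.neg_pi_div_two_lt_arctan (deriv u r / u r / s)
  simp only [id] at hrbig h1
  linarith

theorem tendsto_of_sq_add_sq (hsum : Tendsto (fun r => deriv u r ^ 2 + u r ^ 2) atTop (𝓝 0)) :
    Tendsto u atTop (𝓝 0) ∧ Tendsto (deriv u) atTop (𝓝 0) := by
  have hsqrt := (Real.continuous_sqrt.tendsto 0).comp hsum
  rw [Real.sqrt_zero] at hsqrt
  exact ⟨squeeze_zero_norm (fun r => Real.abs_le_sqrt (by nlinarith [sq_nonneg (deriv u r)])) hsqrt,
    squeeze_zero_norm (fun r => Real.abs_le_sqrt (by nlinarith [sq_nonneg (u r)])) hsqrt⟩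

theorem tendsto_deriv_deriv_zero (h0 : 0 < lam) (h : lam ≤ Lam) (hg : Continuous g)
    (hg0 : g 0 = 0) (hode : ∀ r ∈ radialInterior ⊤, PucciRadialEq lam Lam k g u r)
    (hu : Tendsto u atTop (𝓝 0)) (hu' : Tendsto (deriv u) atTop (𝓝 0)) :
    Tendsto (deriv (deriv u)) atTop (𝓝 0) := by
  have hy : Tendsto (fun r => -(k / r * min (lam * deriv u r) (Lam * deriv u r)) - g (u r)) atTop
      (𝓝 (-(0 * min (lam * 0) (Lam * 0)) - g 0)) :=
    (((tendsto_const_nhds.div_atTop tendsto_id).mul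
      ((hu'.const_mul lam).min (hu'.const_mul Lam))).neg).sub ((hg.tendsto 0).comp hu)
  have hmax := (hy.div_const lam).max (hy.div_const Lam)
  simp only [hg0, mul_zero, min_self, neg_zero, sub_self, zero_div, max_self] at hmax
  refine hmax.congr' ?_
  filter_upwards [eventually_gt_atTop 0] with r hr
  have := hode r (mem_radialInterior_top hr)
  rw [PucciRadialEq, pucciCoef_mul_self h (deriv u r)] at this
  exact ((pucciCoef_mul_eq_iff h0 h _ _).1 (by linarith)).symm

end Asymptotics

theorem pucci_radial_minus_oscillating_positive_data
    (lam Lam : ℝ) (hlam : 0 < lam) (hlamLam : lam ≤ Lam)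
    (N : ℕ) (hN : 2 ≤ N)
    (g : ℝ → ℝ) (hg1 : LocallyLipschitz g)
    (hg2 : ∀ t, g (-t) = - g t)
    (α : ℝ) (hα : 0 < α)
    (hg3pos : ∀ t, 0 < t → t < α → 0 < g t)
    (hg3neg : ∀ t, α < t → g t < 0)
    (g'0 : ℝ) (hg4 : HasDerivAt g g'0 0) (hg4pos : 0 < g'0)
    (ξ : ℝ) (hξ0 : 0 < ξ) (hξα : ξ < α)
    (R : EReal) (hR : 0 < R)
    (u : ℝ → ℝ)
    (hu : ContDiffOn ℝ 2 u {r : ℝ | 0 ≤ r ∧ (r : EReal) < R})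
    (hode : ∀ r : ℝ, 0 < r → (r : EReal) < R →
      (if 0 ≤ deriv (deriv u) r then lam else Lam) * deriv (deriv u) r
        + ((N : ℝ) - 1) / r * ((if 0 ≤ deriv u r then lam else Lam) * deriv u r)
        + g (u r) = 0)
    (hu0 : u 0 = ξ) (hu'0 : deriv u 0 = 0)
    (hmax : ¬ ∃ (R' : EReal) (v : ℝ → ℝ), R < R' ∧
      ContDiffOn ℝ 2 v {r : ℝ | 0 ≤ r ∧ (r : EReal) < R'} ∧
      (∀ r : ℝ, 0 < r → (r : EReal) < R' →
        (if 0 ≤ deriv (deriv v) r then lam else Lam) * deriv (deriv v) r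
        + ((N : ℝ) - 1) / r * ((if 0 ≤ deriv v r then lam else Lam) * deriv v r)
        + g (v r) = 0) ∧
      v 0 = ξ ∧ deriv v 0 = 0 ∧
      (∀ r : ℝ, 0 ≤ r → (r : EReal) < R → v r = u r))
 :
    R = ⊤ ∧
    (∀ M : ℝ, ∃ r, M ≤ r ∧ u r = 0) ∧
    Tendsto u atTop (𝓝 0) ∧ Tendsto (deriv u) atTop (𝓝 0) ∧
    Tendsto (deriv (deriv u)) atTop (𝓝 0) ∧
    sSup ((fun r => |u r|) '' Set.Ici 0) = ξ ∧ ξ < α := by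
  set k : ℝ := (N : ℝ) - 1
  have hk : 0 < k := by
    have : (2 : ℝ) ≤ N := by exact_mod_cast hN
    linarith
  have hg := hg1.continuous
  have hg0 : g 0 = 0 := by
    have := hg2 0
    rw [neg_zero] at this
    linarith
  have hode' : ∀ r ∈ radialInterior R, PucciRadialEq lam Lam k g u r :=
    fun r hr => hode r hr.1 hr.2
  have hband : ∀ r ∈ radialDomain R, u r ∈ Icc (-ξ) ξ := fun r hr => by
    have := mem_Icc_of_pucciRadialEq hlam hlamLam hk hg hg2 hg3pos hR hu hode' (hu0 ▸ hξ0)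
      (hu0 ▸ hξα) hr
    rwa [hu0] at this
  obtain ⟨m, hm, L, hL, hmL⟩ := exists_slope_bounds hg hg2 hg3pos hg4 hg4pos hξ0 hξα
  have htop : R = ⊤ := by
    by_contra hne
    lift R to ℝ using ⟨hne, (EReal.bot_lt_zero.trans hR).ne'⟩
    have hR' : 0 < R := by exact_mod_cast hR
    obtain ⟨R', v, hRR', hv, hvode, hvu⟩ := exists_extension_pucciRadialEq (α := α) (ξ := ξ)
      (B := √(2 * pucciPotential lam Lam g ξ)) hlam hlamLam hk.le hg1 hR' hξα hu hode'
      (fun r hr => abs_le.2 (hband r (radialInterior_subset _ hr))) fun r hr => by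
        have he := pucciEnergy_le hlam hlamLam hk hg hR hu hode' hr
        have hp := (pucciPotential_bounds hlam hlamLam hg hm hL hmL _
          (hband r (radialInterior_subset _ hr))).1
        have hLam := hlam.trans_le hlamLam
        have : 0 ≤ m / (2 * Lam) * u r ^ 2 := by positivity
        rw [hu0] at he
        exact Real.abs_le_sqrt (by linarith)
    refine hmax ⟨R', v, EReal.coe_lt_coe_iff.2 hRR', hv, fun r h1 h2 => hvode r ⟨h1, h2⟩,
      (hvu hR').trans hu0, ?_, fun r _ hr => hvu (EReal.coe_lt_coe_iff.1 hr)⟩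
    rw [(Filter.eventuallyEq_of_mem (Iio_mem_nhds hR') hvu).deriv_eq, hu'0]
  subst htop
  have hband' : ∀ r > 0, u r ∈ Icc (-ξ) ξ := fun r hr =>
    hband r (radialInterior_subset _ (mem_radialInterior_top hr))
  obtain ⟨hlim, hlim'⟩ := tendsto_of_sq_add_sq
    (tendsto_sq_add_sq_zero hlam hlamLam hk hg hm hL hmL hu hode' hband')
  refine ⟨rfl, exists_zero_ge hlam hlamLam hk hm (fun t ht => (hmL t ht).1) hu hode' hband', hlim,
    hlim', tendsto_deriv_deriv_zero hlam hlamLam hg hg0 hode' hlim hlim', ?_, hξα⟩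
  refine IsGreatest.csSup_eq ⟨⟨0, self_mem_Ici, ?_⟩, ?_⟩
  · simp only [hu0, abs_of_pos hξ0]
  · rintro _ ⟨r, hr, rfl⟩
    exact abs_le.2 (hband r ⟨hr, EReal.coe_lt_top r⟩)
end

section
/- Let ξ ∈ ℝ with 0 < ξ < α, and let u ∈ C²([0,R)) with u(0) = ξ and u'(0) = 0 be the solution of the radial Pucci equation for M⁺ on its maximal interval of existence [0,R). Then there exists r₁ ∈ (0,R) such that u(r₁) = 0, u > 0 on [0,r₁), and u' < 0 on (0,r₁]. -/
open Set Filter Topology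

/-- The second derivative of a radial solution, solved from the radial Pucci equation in
dimension `l + 2`, as a function of the radius, the value and the slope. -/
noncomputable def pucciAccel (lam Lam : ℝ) (l : ℕ) (g : ℝ → ℝ) (r x p : ℝ) : ℝ :=
  min (-(((l : ℝ) + 1) / r * max (lam * p) (Lam * p) + g x) / lam)
    (-(((l : ℝ) + 1) / r * max (lam * p) (Lam * p) + g x) / Lam)

/-- The pair `(u, w)` solves the first order system associated with the radial Pucci equation
on the set `s`. -/
def IsPucciFlow (lam Lam : ℝ) (l : ℕ) (g : ℝ → ℝ) (u w : ℝ → ℝ) (s : Set ℝ) : Prop :=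
  ∀ r ∈ s, HasDerivAt u (w r) r ∧ HasDerivAt w (pucciAccel lam Lam l g r (u r) (w r)) r

section

variable {lam Lam : ℝ} {l : ℕ} {g : ℝ → ℝ}

lemma max_mul_of_nonneg_slope (h : lam ≤ Lam) {p : ℝ} (hp : 0 ≤ p) :
    max (lam * p) (Lam * p) = Lam * p :=
  max_eq_right (mul_le_mul_of_nonneg_right h hp)

lemma max_mul_of_nonpos_slope (h : lam ≤ Lam) {p : ℝ} (hp : p ≤ 0) :
    max (lam * p) (Lam * p) = lam * p :=
  max_eq_left (mul_le_mul_of_nonpos_right h hp)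

lemma min_div_of_nonneg (h0 : 0 < lam) (h : lam ≤ Lam) {q : ℝ} (hq : 0 ≤ q) :
    min (q / lam) (q / Lam) = q / Lam :=
  min_eq_right (div_le_div_of_nonneg_left hq h0 h)

lemma min_div_of_nonpos (h0 : 0 < lam) (h : lam ≤ Lam) {q : ℝ} (hq : q ≤ 0) :
    min (q / lam) (q / Lam) = q / lam := by
  refine min_eq_left ?_
  have := div_le_div_of_nonneg_left (neg_nonneg.2 hq) h0 h
  simp only [neg_div] at this
  linarith

lemma ite_mul_eq_max (h : lam ≤ Lam) (p : ℝ) :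
    (if 0 ≤ p then Lam else lam) * p = max (lam * p) (Lam * p) := by
  split_ifs with hp
  · exact (max_mul_of_nonneg_slope h hp).symm
  · exact (max_mul_of_nonpos_slope h (not_le.1 hp).le).symm

lemma ite_mul_eq_iff (h0 : 0 < lam) (h : lam ≤ Lam) (a q : ℝ) :
    (if 0 ≤ a then Lam else lam) * a = q ↔ a = min (q / lam) (q / Lam) := by
  have hL : 0 < Lam := h0.trans_le h
  constructor
  · rintro rfl
    split_ifs with ha
    · rw [min_div_of_nonneg h0 h (by positivity)]
      field_simp
    · rw [min_div_of_nonpos h0 h (mul_nonpos_of_nonneg_of_nonpos h0.le (not_le.1 ha).le)]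
      field_simp
  · rintro rfl
    rcases le_or_gt 0 q with hq | hq
    · rw [min_div_of_nonneg h0 h hq, if_pos (by positivity)]
      field_simp
    · rw [min_div_of_nonpos h0 h hq.le, if_neg (not_le.2 (div_neg_of_neg_of_pos hq h0))]
      field_simp

/-- The radial Pucci equation in solved form. -/
lemma pucci_eq_iff (h0 : 0 < lam) (h : lam ≤ Lam) (r x p a : ℝ) :
    (if 0 ≤ a then Lam else lam) * a
      + ((l : ℝ) + 1) / r * ((if 0 ≤ p then Lam else lam) * p) + g x = 0 ↔
    a = pucciAccel lam Lam l g r x p := by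
  rw [pucciAccel, ← ite_mul_eq_iff h0 h, ite_mul_eq_max h p]
  constructor <;> intro H <;> linarith

lemma pucciAccel_neg (h0 : 0 < lam) (h : lam ≤ Lam) {r x p : ℝ} (hr : 0 < r) (hp : 0 ≤ p)
    (hg : 0 < g x) : pucciAccel lam Lam l g r x p < 0 := by
  refine (min_le_left _ _).trans_lt (div_neg_of_neg_of_pos ?_ h0)
  have hL : 0 < Lam := h0.trans_le h
  rw [max_mul_of_nonneg_slope h hp, neg_neg_iff_pos]
  positivity

lemma pucciAccel_le (h0 : 0 < lam) (h : lam ≤ Lam) {r x p : ℝ} (hr : 0 < r) (hp : p ≤ 0)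
    (hg : 0 ≤ g x) : pucciAccel lam Lam l g r x p ≤ -(((l : ℝ) + 1) / r * p) - g x / Lam := by
  refine (min_le_left _ _).trans ?_
  rw [max_mul_of_nonpos_slope h hp]
  have h1 : -(((l : ℝ) + 1) / r * (lam * p) + g x) / lam
      = -(((l : ℝ) + 1) / r * p) - g x / lam := by field_simp; ring
  have := div_le_div_of_nonneg_left hg h0 h
  linarith

lemma le_pucciAccel (h0 : 0 < lam) (h : lam ≤ Lam) {r x p : ℝ} (hr : 0 < r) (hp : p ≤ 0)
    (hg : 0 ≤ g x) : -(g x / lam) ≤ pucciAccel lam Lam l g r x p := by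
  have hL : 0 < Lam := h0.trans_le h
  have hq : -g x ≤ -(((l : ℝ) + 1) / r * max (lam * p) (Lam * p) + g x) := by
    rw [max_mul_of_nonpos_slope h hp]
    have : ((l : ℝ) + 1) / r * (lam * p) ≤ 0 :=
      mul_nonpos_of_nonneg_of_nonpos (by positivity) (mul_nonpos_of_nonneg_of_nonpos h0.le hp)
    linarith
  have h2 := div_le_div_of_nonneg_left hg h0 h
  refine le_min ?_ ?_
  · rw [← neg_div]; gcongr
  · have : -g x / Lam ≤ -(((l : ℝ) + 1) / r * max (lam * p) (Lam * p) + g x) / Lam := by gcongr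
    rw [neg_div] at this
    linarith

end

lemma antitoneOn_of_hasDerivAt_nonpos {s : Set ℝ} (hs : Convex ℝ s) {f f' : ℝ → ℝ}
    (hf : ContinuousOn f s) (hf' : ∀ x ∈ interior s, HasDerivAt f (f' x) x)
    (hn : ∀ x ∈ interior s, f' x ≤ 0) : AntitoneOn f s :=
  antitoneOn_of_hasDerivWithinAt_nonpos hs hf (fun x hx => (hf' x hx).hasDerivWithinAt) hn

/-- A function with negative derivative exceeds its value at a point somewhere to the left. -/
lemma exists_lt_of_hasDerivAt_neg {f : ℝ → ℝ} {a x d : ℝ} (hax : a < x) (hf : HasDerivAt f d x)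
    (hd : d < 0) : ∃ y, a < y ∧ y < x ∧ f x < f y := by
  have h1 := (hasDerivAt_iff_tendsto_slope.1 hf).mono_left
    (nhdsWithin_mono x (fun y (hy : y < x) => hy.ne) : 𝓝[<] x ≤ 𝓝[≠] x)
  obtain ⟨y, hy, hy2⟩ := ((h1.eventually (gt_mem_nhds hd)).and (Ioo_mem_nhdsLT hax)).exists
  refine ⟨y, hy2.1, hy2.2, ?_⟩
  rw [slope_def_field, div_neg_iff] at hy
  rcases hy with h | h <;> linarith [h.1, h.2, hy2.2]

section

variable {lam Lam : ℝ} {l : ℕ} {g u w : ℝ → ℝ}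

/-- While the force is positive, the slope of a radial solution is negative. -/
lemma slope_neg_of_force_pos (h0 : 0 < lam) (h : lam ≤ Lam) {T : ℝ} (hT : 0 < T)
    (hwc : ContinuousOn w (Icc 0 T)) (hw0 : w 0 = 0)
    (hflow : IsPucciFlow lam Lam l g u w (Ioc 0 T)) (hg : ∀ r ∈ Ioc 0 T, 0 < g (u r)) :
    w T < 0 := by
  by_contra! hc
  have key : ∀ r ∈ Ioc 0 T, 0 ≤ w r → ∃ y ∈ Icc 0 T, w r < w y := by
    intro r hr hwr
    obtain ⟨y, hy1, hy2, hy3⟩ := exists_lt_of_hasDerivAt_neg hr.1 (hflow r hr).2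
      (pucciAccel_neg h0 h hr.1 hwr (hg r hr))
    exact ⟨y, ⟨hy1.le, hy2.le.trans hr.2⟩, hy3⟩
  obtain ⟨r, hr, hmax⟩ := isCompact_Icc.exists_isMaxOn ⟨0, left_mem_Icc.2 hT.le⟩ hwc
  have hTr : w T ≤ w r := hmax (right_mem_Icc.2 hT.le)
  rcases hr.1.eq_or_lt with h1 | h1
  · subst h1
    obtain ⟨y, hy, hlt⟩ := key T ⟨hT, le_rfl⟩ hc
    have hyr : w y ≤ w 0 := hmax hy
    linarith
  · obtain ⟨y, hy, hlt⟩ := key r ⟨h1, hr.2⟩ (hc.trans hTr)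
    exact absurd hlt (not_lt.2 (hmax hy))

/-- A radial solution starting below `α` has negative slope up to and including its first zero. -/
lemma slope_neg_of_pos (h0 : 0 < lam) (h : lam ≤ Lam) {α T : ℝ} (hT : 0 < T)
    (hgpos : ∀ t, 0 < t → t < α → 0 < g t)
    (huc : ContinuousOn u (Icc 0 T)) (hwc : ContinuousOn w (Icc 0 T)) (hw0 : w 0 = 0)
    (hu0 : u 0 < α) (hflow : IsPucciFlow lam Lam l g u w (Ioc 0 T))
    (hpos : ∀ r ∈ Ico 0 T, 0 < u r) :
    ∀ r ∈ Ioc 0 T, w r < 0 := by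
  have step : ∀ s, s < T → (∀ r ∈ Ioc 0 s, u r < α) → ∀ r ∈ Ioc 0 s, w r < 0 := by
    intro s hs hα r hr
    have hrT : r ≤ T := hr.2.trans hs.le
    refine slope_neg_of_force_pos h0 h hr.1 (hwc.mono (Icc_subset_Icc_right hrT)) hw0
      (fun x hx => hflow x ⟨hx.1, hx.2.trans hrT⟩) fun x hx => ?_
    exact hgpos _ (hpos x ⟨hx.1.le, (hx.2.trans hr.2).trans_lt hs⟩) (hα x ⟨hx.1, hx.2.trans hr.2⟩)
  have hlt : ∀ r ∈ Icc 0 T, u r < α := by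
    by_contra! hc
    obtain ⟨r, hr, hur⟩ := hc
    have hcl : IsCompact (Icc 0 T ∩ u ⁻¹' Ici α) :=
      isCompact_Icc.of_isClosed_subset (huc.preimage_isClosed_of_isClosed isClosed_Icc isClosed_Ici)
        inter_subset_left
    obtain ⟨s, ⟨hs, hus⟩, hmin⟩ := hcl.exists_isLeast ⟨r, hr, hur⟩
    have hbelow : ∀ x, 0 ≤ x → x < s → u x < α := by
      intro x hx hxs
      by_contra! hx2
      exact absurd (hmin ⟨⟨hx, hxs.le.trans hs.2⟩, hx2⟩) (not_le.2 hxs)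
    have hanti : AntitoneOn u (Icc 0 s) := by
      refine antitoneOn_of_hasDerivAt_nonpos (f' := w) (convex_Icc 0 s)
        (huc.mono (Icc_subset_Icc_right hs.2)) ?_ ?_ <;> rw [interior_Icc] <;> intro x hx
      · exact (hflow x ⟨hx.1, hx.2.le.trans hs.2⟩).1
      · exact (step x (hx.2.trans_le hs.2) (fun y hy => hbelow y hy.1.le (hy.2.trans_lt hx.2)) x
          ⟨hx.1, le_rfl⟩).le
    have := hanti (left_mem_Icc.2 hs.1) (right_mem_Icc.2 hs.1) hs.1
    have hus' : α ≤ u s := hus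
    linarith
  have hint : ∀ r ∈ Ioo 0 T, w r < 0 := fun r hr =>
    step r hr.2 (fun x hx => hlt x ⟨hx.1.le, hx.2.trans hr.2.le⟩) r ⟨hr.1, le_rfl⟩
  intro r hr
  rcases hr.2.lt_or_eq with h1 | rfl
  · exact hint r ⟨hr.1, h1⟩
  have hanti : AntitoneOn (fun x => x ^ (l + 1) * w x) (Icc (r / 2) r) := by
    refine antitoneOn_of_hasDerivAt_nonpos (convex_Icc _ _)
      (f' := fun x => (((l + 1 : ℕ) : ℝ) * x ^ l) * w x
        + x ^ (l + 1) * pucciAccel lam Lam l g x (u x) (w x))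
      ((continuous_pow _).continuousOn.mul (hwc.mono (Icc_subset_Icc_left (by linarith)))) ?_ ?_ <;>
      rw [interior_Icc] <;> intro x hx
    · exact (hasDerivAt_pow (l + 1) x).mul (hflow x ⟨by linarith [hx.1], hx.2.le⟩).2
    · have hx0 : 0 < x := by linarith [hx.1]
      have hgx : 0 < g (u x) := hgpos _ (hpos x ⟨hx0.le, hx.2⟩) (hlt x ⟨hx0.le, hx.2.le⟩)
      have h1 := pucciAccel_le (l := l) h0 h hx0 (hint x ⟨hx0, hx.2⟩).le hgx.le
      have h2 : 0 ≤ g (u x) / Lam := div_nonneg hgx.le (h0.le.trans h)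
      have h3 : x ^ (l + 1) * pucciAccel lam Lam l g x (u x) (w x)
          ≤ x ^ (l + 1) * -(((l : ℝ) + 1) / x * w x) := by gcongr; linarith
      have h4 : x ^ (l + 1) * -(((l : ℝ) + 1) / x * w x)
          = -((((l + 1 : ℕ) : ℝ) * x ^ l) * w x) := by
        push_cast; field_simp; ring
      linarith
  have h1 := hanti (left_mem_Icc.2 (by linarith)) (right_mem_Icc.2 (by linarith))
    (by linarith : r / 2 ≤ r)
  have h2 : (r / 2) ^ (l + 1) * w (r / 2) < 0 :=
    mul_neg_of_pos_of_neg (by positivity) (hint _ ⟨by linarith, by linarith⟩)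
  have h3 : r ^ (l + 1) * w r < 0 := h1.trans_lt h2
  exact (pos_iff_neg_of_mul_neg h3).1 (by positivity)

/-- A decreasing radial solution on the half line with force bounded below by a positive multiple
of its value cannot stay positive. -/
lemma not_pos_on_halfline (h0 : 0 < lam) (h : lam ≤ Lam) {k : ℝ} (hk : 0 < k)
    (huc : ContinuousOn u (Ici 0)) (hwc : ContinuousOn w (Ici 0))
    (hflow : IsPucciFlow lam Lam l g u w (Ioi 0)) (hw : ∀ r, 0 < r → w r < 0)
    (hg : ∀ r, 0 < r → k * u r ≤ g (u r)) (hpos : ∀ r, 0 < r → 0 < u r) : False := by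
  have hL : 0 < Lam := h0.trans_le h
  set m : ℝ := (l : ℝ) + 1 with hm
  have hm0 : 0 < m := by positivity
  set κ : ℝ := k / Lam with hκ
  have hκ0 : 0 < κ := by positivity
  have hacc : ∀ r, 0 < r → pucciAccel lam Lam l g r (u r) (w r) ≤ -(m / r * w r) - κ * u r := by
    intro r hr
    have hku : 0 < k * u r := mul_pos hk (hpos r hr)
    have h1 := pucciAccel_le (l := l) h0 h hr (hw r hr).le (hku.le.trans (hg r hr))
    have h2 : κ * u r ≤ g (u r) / Lam := by
      rw [hκ, div_mul_eq_mul_div]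
      exact div_le_div_of_nonneg_right (hg r hr) hL.le
    linarith
  have hflux : ∀ r, 0 < r → r ^ (l + 1) * w r + κ / (m + 1) * r ^ (l + 2) * u r ≤ 0 := by
    have hanti : AntitoneOn
        (fun r => r ^ (l + 1) * w r + κ / (m + 1) * r ^ (l + 2) * u r) (Ici 0) := by
      refine antitoneOn_of_hasDerivAt_nonpos (convex_Ici 0)
        (f' := fun x => ((((l + 1 : ℕ) : ℝ) * x ^ l) * w x
          + x ^ (l + 1) * pucciAccel lam Lam l g x (u x) (w x))
          + (κ / (m + 1) * (((l + 2 : ℕ) : ℝ) * x ^ (l + 1)) * u x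
            + κ / (m + 1) * x ^ (l + 2) * w x)) (by fun_prop) ?_ ?_ <;>
        rw [interior_Ici] <;> intro x hx
      · exact ((hasDerivAt_pow (l + 1) x).mul (hflow x hx).2).add
          (((hasDerivAt_pow (l + 2) x).const_mul _).mul (hflow x hx).1)
      · have hx0 : 0 < x := hx
        have h1 : x ^ (l + 1) * pucciAccel lam Lam l g x (u x) (w x)
            ≤ x ^ (l + 1) * (-(m / x * w x) - κ * u x) := by gcongr; exact hacc x hx0
        have h2 : x ^ (l + 1) * (-(m / x * w x) - κ * u x)
            = -((((l + 1 : ℕ) : ℝ) * x ^ l) * w x) - x ^ (l + 1) * κ * u x := by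
          push_cast; rw [hm]; field_simp; ring
        have h3 : κ / (m + 1) * (((l + 2 : ℕ) : ℝ) * x ^ (l + 1)) * u x
            = x ^ (l + 1) * κ * u x := by
          have : ((l + 2 : ℕ) : ℝ) = m + 1 := by push_cast; rw [hm]; ring
          rw [this]; field_simp
        have h4 : κ / (m + 1) * x ^ (l + 2) * w x ≤ 0 :=
          mul_nonpos_of_nonneg_of_nonpos (by positivity) (hw x hx0).le
        linarith
    intro r hr
    simpa using hanti self_mem_Ici (mem_Ici.2 hr.le) hr.le
  have hquot : ∀ r, 0 < r → -u r / w r ≤ (m + 1) / (κ * r) := by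
    intro r hr
    have h1 : r ^ (l + 1) * (w r + κ / (m + 1) * r * u r) ≤ 0 := by
      have := hflux r hr
      calc _ = r ^ (l + 1) * w r + κ / (m + 1) * r ^ (l + 2) * u r := by ring
        _ ≤ 0 := this
    have h2 : w r + κ / (m + 1) * r * u r ≤ 0 :=
      nonpos_of_mul_nonpos_right h1 (by positivity)
    have h3 : u r * (κ * r) ≤ (m + 1) * -w r := by
      have : (m + 1) * (w r + κ / (m + 1) * r * u r) ≤ 0 :=
        mul_nonpos_of_nonneg_of_nonpos (by positivity) h2
      have e : (m + 1) * (w r + κ / (m + 1) * r * u r) = (m + 1) * w r + u r * (κ * r) := by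
        field_simp
      linarith
    rw [neg_div, ← div_neg, div_le_div_iff₀ (neg_pos.2 (hw r hr)) (by positivity)]
    exact h3
  obtain ⟨r₀, hr₀, hr₀'⟩ : ∃ r₀ : ℝ, 0 < r₀ ∧ ∀ r, r₀ ≤ r → m * ((m + 1) / (κ * r)) / r ≤ 1 / 2 := by
    refine ⟨max 1 (2 * m * (m + 1) / κ), by positivity, fun r hr => ?_⟩
    have hr1 : 1 ≤ r := (le_max_left _ _).trans hr
    have hr2 : 2 * m * (m + 1) ≤ r * κ := (div_le_iff₀ hκ0).1 ((le_max_right _ _).trans hr)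
    have hr0 : 0 < r := by linarith
    have : m * ((m + 1) / (κ * r)) / r = m * (m + 1) / (κ * r * r) := by field_simp
    rw [this, div_le_div_iff₀ (by positivity) two_pos]
    nlinarith [mul_pos hκ0 hr0]
  have hanti : AntitoneOn (fun r => -u r / w r + r / 2) (Ici r₀) := by
    refine antitoneOn_of_hasDerivAt_nonpos (convex_Ici r₀)
      (f' := fun x => (-w x * w x - -u x * pucciAccel lam Lam l g x (u x) (w x)) / w x ^ 2 + 1 / 2)
      ?_ ?_ ?_
    · have hsub : Ici r₀ ⊆ Ici 0 := Ici_subset_Ici.2 hr₀.le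
      exact (((huc.mono hsub).neg).div (hwc.mono hsub)
        fun x hx => (hw x (hr₀.trans_le hx)).ne).add (by fun_prop)
    all_goals
      rw [interior_Ici]
      intro x hx
      have hx0 : 0 < x := hr₀.trans hx
    · exact ((hflow x hx0).1.neg.div (hflow x hx0).2 (hw x hx0).ne).add
        ((hasDerivAt_id x).div_const 2)
    · have hwx := hw x hx0
      have hux := hpos x hx0
      have h1 : u x * pucciAccel lam Lam l g x (u x) (w x) ≤ u x * -(m / x * w x) := by
        gcongr
        linarith [hacc x hx0, mul_pos hκ0 hux]
      have h2 : (-w x * w x - -u x * pucciAccel lam Lam l g x (u x) (w x)) / w x ^ 2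
          ≤ (-w x * w x + u x * -(m / x * w x)) / w x ^ 2 := by
        gcongr; linarith
      have h3 : (-w x * w x + u x * -(m / x * w x)) / w x ^ 2 = -1 + m * (-u x / w x) / x := by
        have := hwx.ne
        field_simp
      have h4 : m * (-u x / w x) / x ≤ m * ((m + 1) / (κ * x)) / x := by
        have := mul_le_mul_of_nonneg_left (hquot x hx0) hm0.le
        exact div_le_div_of_nonneg_right this hx0.le
      have := hr₀' x (le_of_lt hx)
      linarith
  have hq : ∀ r, 0 < r → 0 < -u r / w r := fun r hr =>
    div_pos_of_neg_of_neg (neg_lt_zero.2 (hpos r hr)) (hw r hr)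
  have hq0 := hq r₀ hr₀
  have h1 := hanti self_mem_Ici (by simp only [mem_Ici]; linarith :
    r₀ + 2 * (-u r₀ / w r₀) ∈ Ici r₀) (by linarith)
  have h2 := hq (r₀ + 2 * (-u r₀ / w r₀)) (by linarith)
  simp only at h1
  linarith

end

/-- **Picard–Lindelöf** for a jointly locally Lipschitz time-dependent vector field. -/
lemma LocallyLipschitz.exists_forall_mem_Ioo_hasDerivAt {E : Type*} [NormedAddCommGroup E]
    [NormedSpace ℝ E] [CompleteSpace E] {f : ℝ → E → E}
    (hf : LocallyLipschitz (fun p : ℝ × E => f p.1 p.2)) (t₀ : ℝ) (x₀ : E) :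
    ∃ ε > 0, ∃ y : ℝ → E, y t₀ = x₀ ∧
      ∀ t ∈ Ioo (t₀ - ε) (t₀ + ε), HasDerivAt y (f t (y t)) t := by
  obtain ⟨K, s, hs, hK⟩ := hf (t₀, x₀)
  obtain ⟨δ, hδ, hball⟩ := Metric.nhds_basis_closedBall.mem_iff.1 hs
  have hmem : ∀ t x, |t - t₀| ≤ δ → x ∈ Metric.closedBall x₀ δ → (t, x) ∈ s := by
    intro t x ht hx
    refine hball ?_
    rw [← closedBall_prod_same]
    exact ⟨by simpa [Real.dist_eq] using ht, hx⟩
  have hmem0 : (t₀, x₀) ∈ s := mem_of_mem_nhds hs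
  set L : ℝ := ‖f t₀ x₀‖ + K * δ with hL
  have hL0 : 0 ≤ L := by positivity
  set ε : ℝ := min δ (δ / (L + 1)) with hε
  have hε0 : 0 < ε := by positivity
  have hεδ : ε ≤ δ := min_le_left _ _
  have habs : ∀ t ∈ Icc (t₀ - ε) (t₀ + ε), |t - t₀| ≤ δ := fun t ht =>
    abs_le.2 ⟨by linarith [ht.1], by linarith [ht.2]⟩
  have hpl : IsPicardLindelof f (tmin := t₀ - ε) (tmax := t₀ + ε)
      ⟨t₀, by simp [hε0.le]⟩ x₀ ⟨δ, hδ.le⟩ 0 ⟨L, hL0⟩ K := by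
    refine ⟨fun t ht => ?_, fun x hx => ?_, fun t ht x hx => ?_, ?_⟩
    · refine LipschitzOnWith.of_dist_le_mul fun x hx y hy => ?_
      have := hK.dist_le_mul _ (hmem t x (habs t ht) hx) _ (hmem t y (habs t ht) hy)
      simpa [Prod.dist_eq] using this
    · have h1 : ContinuousOn (fun t : ℝ => (t, x)) (Icc (t₀ - ε) (t₀ + ε)) := by fun_prop
      exact hK.continuousOn.comp h1 fun t ht => hmem t x (habs t ht) hx
    · have h1 := hK.dist_le_mul _ (hmem t x (habs t ht) hx) _ hmem0
      have h2 : dist (t, x) (t₀, x₀) ≤ δ := by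
        rw [Prod.dist_eq]
        exact max_le (by simpa [Real.dist_eq] using habs t ht) hx
      have h3 : (K : ℝ) * dist (t, x) (t₀, x₀) ≤ K * δ := by gcongr
      have h4 := norm_le_norm_add_norm_sub' (f t x) (f t₀ x₀)
      rw [dist_eq_norm] at h1
      change ‖f t x‖ ≤ L
      linarith
    · have h1 : L * ε ≤ L * (δ / (L + 1)) := by gcongr; exact min_le_right _ _
      have h2 : L * (δ / (L + 1)) ≤ δ := by
        rw [mul_div_assoc', div_le_iff₀ (by positivity)]
        linarith
      change L * max (t₀ + ε - t₀) (t₀ - (t₀ - ε)) ≤ δ - 0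
      rw [add_sub_cancel_left, sub_sub_cancel, max_self, sub_zero]
      exact h1.trans h2
  obtain ⟨y, hy0, hy⟩ := hpl.exists_eq_forall_mem_Icc_hasDerivWithinAt₀
  exact ⟨ε, hε0, y, hy0, fun t ht =>
    (hy t (Ioo_subset_Icc_self ht)).hasDerivAt (Icc_mem_nhds ht.1 ht.2)⟩

lemma hasDerivAt_of_hasDerivAt_punctured {f d : ℝ → ℝ} {a b x : ℝ} (hx : x ∈ Ioo a b)
    (hf : ∀ y ∈ Ioo a b, y ≠ x → HasDerivAt f (d y) y) (hfc : ContinuousAt f x)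
    (hdc : ContinuousAt d x) : HasDerivAt f (d x) x := by
  have hr : Ioo x b ∈ 𝓝[>] x := Ioo_mem_nhdsGT hx.2
  have hl : Ioo a x ∈ 𝓝[<] x := Ioo_mem_nhdsLT hx.1
  have hfr : ∀ y ∈ Ioo x b, HasDerivAt f (d y) y := fun y hy =>
    hf y ⟨hx.1.trans hy.1, hy.2⟩ hy.1.ne'
  have hfl : ∀ y ∈ Ioo a x, HasDerivAt f (d y) y := fun y hy =>
    hf y ⟨hy.1, hy.2.trans hx.2⟩ hy.2.ne
  have h1 : HasDerivWithinAt f (d x) (Ici x) x :=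
    hasDerivWithinAt_Ici_of_tendsto_deriv
      (fun y hy => (hfr y hy).differentiableAt.differentiableWithinAt) hfc.continuousWithinAt hr
      ((tendsto_inf_left hdc).congr' (by filter_upwards [hr] with y hy using (hfr y hy).deriv.symm))
  have h2 : HasDerivWithinAt f (d x) (Iic x) x :=
    hasDerivWithinAt_Iic_of_tendsto_deriv
      (fun y hy => (hfl y hy).differentiableAt.differentiableWithinAt) hfc.continuousWithinAt hl
      ((tendsto_inf_left hdc).congr' (by filter_upwards [hl] with y hy using (hfl y hy).deriv.symm))
  simpa using h1.union h2

lemma contDiffOn_two_of_hasDerivAt {f d e : ℝ → ℝ} {s : Set ℝ} (hs : IsOpen s)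
    (hf : ∀ x ∈ s, HasDerivAt f (d x) x) (hd : ∀ x ∈ s, HasDerivAt d (e x) x)
    (he : ContinuousOn e s) : ContDiffOn ℝ 2 f s := by
  have h1 : ContDiffOn ℝ 1 d s := by
    rw [show (1 : WithTop ℕ∞) = 0 + 1 by norm_num, contDiffOn_succ_iff_deriv_of_isOpen hs]
    exact ⟨fun x hx => (hd x hx).differentiableAt.differentiableWithinAt, by simp,
      contDiffOn_zero.2 (he.congr fun x hx => (hd x hx).deriv)⟩
  rw [show (2 : WithTop ℕ∞) = 1 + 1 by norm_num, contDiffOn_succ_iff_deriv_of_isOpen hs]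
  exact ⟨fun x hx => (hf x hx).differentiableAt.differentiableWithinAt, by simp,
    h1.congr fun x hx => (hf x hx).deriv⟩

lemma LocallyLipschitz.real_mul {X : Type*} [PseudoEMetricSpace X] {f g : X → ℝ}
    (hf : LocallyLipschitz f) (hg : LocallyLipschitz g) :
    LocallyLipschitz (fun x => f x * g x) :=
  (contDiff_mul (𝕜 := ℝ) (𝔸 := ℝ) (n := 1)).locallyLipschitz.comp (hf.prodMk hg)

lemma locallyLipschitz_inv_max {c : ℝ} (hc : 0 < c) :
    LocallyLipschitz (fun t : ℝ => (max t c)⁻¹) := by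
  refine (LipschitzWith.of_dist_le' (K := (c * c)⁻¹) fun x y => ?_).locallyLipschitz
  have hx : c ≤ max x c := le_max_right _ _
  have hy : c ≤ max y c := le_max_right _ _
  have hx0 := hc.trans_le hx
  have hy0 := hc.trans_le hy
  have h1 : |max y c - max x c| ≤ |x - y| := by
    rw [abs_sub_comm x y]
    exact abs_max_sub_max_le_abs y x c
  rw [Real.dist_eq, Real.dist_eq, inv_sub_inv hx0.ne' hy0.ne', abs_div,
    abs_of_pos (mul_pos hx0 hy0), div_eq_inv_mul]
  gcongr

section

variable {lam Lam : ℝ} {l : ℕ} {g u w : ℝ → ℝ}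

lemma locallyLipschitz_pucciAccel (hg : LocallyLipschitz g) {c : ℝ} (hc : 0 < c) :
    LocallyLipschitz
      (fun p : ℝ × ℝ × ℝ => (p.2.2, pucciAccel lam Lam l g (max p.1 c) p.2.1 p.2.2)) := by
  have h1 : LocallyLipschitz (fun p : ℝ × ℝ × ℝ => p.1) := LipschitzWith.prod_fst.locallyLipschitz
  have h2 : LocallyLipschitz (fun p : ℝ × ℝ × ℝ => p.2.1) :=
    (LipschitzWith.prod_fst.comp LipschitzWith.prod_snd).locallyLipschitz
  have h3 : LocallyLipschitz (fun p : ℝ × ℝ × ℝ => p.2.2) :=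
    (LipschitzWith.prod_snd.comp LipschitzWith.prod_snd).locallyLipschitz
  have h4 := ((LocallyLipschitz.const ((l : ℝ) + 1)).real_mul
    ((locallyLipschitz_inv_max hc).comp h1)).real_mul
    (((LocallyLipschitz.const lam).real_mul h3).max ((LocallyLipschitz.const Lam).real_mul h3))
  have h5 := (h4.add (hg.comp h2)).neg
  exact h3.prodMk ((h5.real_mul (LocallyLipschitz.const lam⁻¹)).min
    (h5.real_mul (LocallyLipschitz.const Lam⁻¹)))

lemma continuousAt_pucciAccel (hg : Continuous g) {r : ℝ} (hr : r ≠ 0) (hu : ContinuousAt u r)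
    (hw : ContinuousAt w r) :
    ContinuousAt (fun t => pucciAccel lam Lam l g t (u t) (w t)) r := by
  have h1 : ContinuousAt (fun t : ℝ => ((l : ℝ) + 1) / t) r := by fun_prop (disch := assumption)
  have h2 : ContinuousAt (fun t => g (u t)) r := hg.continuousAt.comp hu
  unfold pucciAccel
  fun_prop

/-- A solution of the radial system whose value and slope converge at the right endpoint of its
interval can be continued past that endpoint. -/
lemma IsPucciFlow.exists_extension (hg : LocallyLipschitz g) {ρ a b : ℝ} (hρ : 0 < ρ)
    (hflow : IsPucciFlow lam Lam l g u w (Ioo 0 ρ)) (ha : Tendsto u (𝓝[<] ρ) (𝓝 a))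
    (hb : Tendsto w (𝓝[<] ρ) (𝓝 b)) :
    ∃ ε > 0, ∃ U V : ℝ → ℝ, (∀ r < ρ, U r = u r) ∧ IsPucciFlow lam Lam l g U V (Ioo 0 (ρ + ε)) := by
  obtain ⟨ε, hε, y, hy0, hy⟩ :=
    (locallyLipschitz_pucciAccel (lam := lam) (Lam := Lam) (l := l) hg
      (half_pos hρ)).exists_forall_mem_Ioo_hasDerivAt
      (f := fun t x => (x.2, pucciAccel lam Lam l g (max t (ρ / 2)) x.1 x.2)) ρ (a, b)
  set U : ℝ → ℝ := fun r => if r < ρ then u r else (y r).1 with hU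
  set V : ℝ → ℝ := fun r => if r < ρ then w r else (y r).2 with hV
  have hleft : ∀ r < ρ, U =ᶠ[𝓝 r] u ∧ V =ᶠ[𝓝 r] w := fun r hr =>
    ⟨by filter_upwards [Iio_mem_nhds hr] with x hx using if_pos hx,
      by filter_upwards [Iio_mem_nhds hr] with x hx using if_pos hx⟩
  have hright : ∀ r > ρ, U =ᶠ[𝓝 r] (fun t => (y t).1) ∧ V =ᶠ[𝓝 r] fun t => (y t).2 := fun r hr =>
    ⟨by filter_upwards [Ioi_mem_nhds hr] with x hx using if_neg (not_lt.2 (le_of_lt hx)),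
      by filter_upwards [Ioi_mem_nhds hr] with x hx using if_neg (not_lt.2 (le_of_lt hx))⟩
  have hne : ∀ r ∈ Ioo 0 (ρ + ε), r ≠ ρ →
      HasDerivAt U (V r) r ∧ HasDerivAt V (pucciAccel lam Lam l g r (U r) (V r)) r := by
    intro r hr hrρ
    rcases lt_or_gt_of_ne hrρ with h | h
    · obtain ⟨h1, h2⟩ := hleft r h
      rw [h1.eq_of_nhds, h2.eq_of_nhds]
      exact ⟨(hflow r ⟨hr.1, h⟩).1.congr_of_eventuallyEq h1,
        (hflow r ⟨hr.1, h⟩).2.congr_of_eventuallyEq h2⟩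
    · obtain ⟨h1, h2⟩ := hright r h
      rw [h1.eq_of_nhds, h2.eq_of_nhds]
      have h3 := hy r ⟨by linarith, hr.2⟩
      rw [max_eq_left (by linarith : ρ / 2 ≤ r)] at h3
      exact ⟨(hasFDerivAt_fst.comp_hasDerivAt r h3).congr_of_eventuallyEq h1,
        (hasFDerivAt_snd.comp_hasDerivAt r h3).congr_of_eventuallyEq h2⟩
  have hyc : ContinuousAt y ρ := (hy ρ ⟨by linarith, by linarith⟩).continuousAt
  have hUρ : U ρ = a := by simp [hU, hy0]
  have hVρ : V ρ = b := by simp [hV, hy0]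
  have hUc : ContinuousAt U ρ := by
    rw [continuousAt_iff_continuous_left'_right', ContinuousWithinAt, ContinuousWithinAt, hUρ]
    refine ⟨ha.congr' ?_, ?_⟩
    · filter_upwards [self_mem_nhdsWithin] with x hx using (if_pos hx).symm
    · have h1 : Tendsto (fun t => (y t).1) (𝓝[>] ρ) (𝓝 a) := by
        have := (continuous_fst.continuousAt.comp hyc).tendsto
        simp only [Function.comp_def, hy0] at this
        exact tendsto_inf_left this
      refine h1.congr' ?_
      filter_upwards [self_mem_nhdsWithin] with x hx using (if_neg (not_lt.2 (le_of_lt hx))).symm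
  have hVc : ContinuousAt V ρ := by
    rw [continuousAt_iff_continuous_left'_right', ContinuousWithinAt, ContinuousWithinAt, hVρ]
    refine ⟨hb.congr' ?_, ?_⟩
    · filter_upwards [self_mem_nhdsWithin] with x hx using (if_pos hx).symm
    · have h1 : Tendsto (fun t => (y t).2) (𝓝[>] ρ) (𝓝 b) := by
        have := (continuous_snd.continuousAt.comp hyc).tendsto
        simp only [Function.comp_def, hy0] at this
        exact tendsto_inf_left this
      refine h1.congr' ?_
      filter_upwards [self_mem_nhdsWithin] with x hx using (if_neg (not_lt.2 (le_of_lt hx))).symm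
  refine ⟨ε, hε, U, V, fun r hr => if_pos hr, fun r hr => ?_⟩
  by_cases hrρ : r = ρ
  · subst hrρ
    exact ⟨hasDerivAt_of_hasDerivAt_punctured hr (fun y hy hyr => (hne y hy hyr).1) hUc hVc,
      hasDerivAt_of_hasDerivAt_punctured
        (d := fun t => pucciAccel lam Lam l g t (U t) (V t)) hr
        (fun y hy hyr => (hne y hy hyr).2) hVc
        (continuousAt_pucciAccel hg.continuous hr.1.ne' hUc hVc)⟩
  · exact hne r hr hrρ

/-- A positive decreasing radial solution on a bounded interval has limits of its value and slope
at the right endpoint. -/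
lemma IsPucciFlow.exists_tendsto (h0 : 0 < lam) (h : lam ≤ Lam) {ρ C : ℝ} (hρ : 0 < ρ)
    (hflow : IsPucciFlow lam Lam l g u w (Ioo 0 ρ)) (hw : ∀ r ∈ Ioo 0 ρ, w r < 0)
    (hu : ∀ r ∈ Ioo 0 ρ, 0 < u r) (hg : ∀ r ∈ Ioo 0 ρ, 0 ≤ g (u r) ∧ g (u r) ≤ C) :
    (∃ a, Tendsto u (𝓝[<] ρ) (𝓝 a)) ∧ ∃ b, Tendsto w (𝓝[<] ρ) (𝓝 b) := by
  have hne : (Ioo 0 ρ).Nonempty := nonempty_Ioo.2 hρ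
  have hanti : AntitoneOn u (Ioo 0 ρ) := by
    refine antitoneOn_of_hasDerivAt_nonpos (f' := w) (convex_Ioo 0 ρ)
      (fun x hx => (hflow x hx).1.continuousAt.continuousWithinAt) ?_ ?_ <;>
      rw [interior_Ioo] <;> intro x hx
    · exact (hflow x hx).1
    · exact (hw x hx).le
  have hanti' : AntitoneOn (fun x => -(w x + C / lam * x)) (Ioo 0 ρ) := by
    refine antitoneOn_of_hasDerivAt_nonpos
      (f' := fun x => -(pucciAccel lam Lam l g x (u x) (w x) + C / lam * 1)) (convex_Ioo 0 ρ) ?_ ?_ ?_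
    · intro x hx
      have := (hflow x hx).2.continuousAt
      exact ContinuousAt.continuousWithinAt (by fun_prop)
    · rw [interior_Ioo]
      exact fun x hx => ((hflow x hx).2.add ((hasDerivAt_id x).const_mul _)).neg
    · rw [interior_Ioo]
      intro x hx
      have h1 := le_pucciAccel (l := l) h0 h hx.1 (hw x hx).le (hg x hx).1
      have h2 : g (u x) / lam ≤ C / lam := div_le_div_of_nonneg_right (hg x hx).2 h0.le
      linarith
  constructor
  · have := hanti.neg.tendsto_nhdsWithin_Ioo_left hne
      ⟨0, by rintro _ ⟨x, hx, rfl⟩; simpa using (hu x hx).le⟩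
    exact ⟨_, by simpa using this.neg⟩
  · have hmono : MonotoneOn (fun x => w x + C / lam * x) (Ioo 0 ρ) := by simpa using hanti'.neg
    obtain ⟨x₀, hx₀⟩ := hne
    have hC : 0 ≤ C := (hg x₀ hx₀).1.trans (hg x₀ hx₀).2
    have := hmono.tendsto_nhdsWithin_Ioo_left ⟨x₀, hx₀⟩ ⟨C / lam * ρ, by
      rintro _ ⟨x, hx, rfl⟩
      have h1 : C / lam * x ≤ C / lam * ρ := by gcongr; exact hx.2.le
      have h2 := hw x hx
      simp only
      linarith⟩
    have hlin : Tendsto (fun x => C / lam * x) (𝓝[<] ρ) (𝓝 (C / lam * ρ)) :=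
      ((continuous_const_mul _).tendsto ρ).mono_left nhdsWithin_le_nhds
    exact ⟨_, by simpa using this.sub hlin⟩

end

section

variable {lam Lam : ℝ} {l : ℕ} {g u : ℝ → ℝ} {R : EReal}

lemma isOpen_setOf_pos_lt : IsOpen {r : ℝ | 0 < r ∧ (r : EReal) < R} :=
  (isOpen_lt continuous_const continuous_id).inter
    (isOpen_lt continuous_coe_real_ereal continuous_const)

lemma uniqueDiffOn_setOf_nonneg_lt (hR : 0 < R) :
    UniqueDiffOn ℝ {r : ℝ | 0 ≤ r ∧ (r : EReal) < R} := by
  have hconn : OrdConnected {r : ℝ | 0 ≤ r ∧ (r : EReal) < R} :=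
    ⟨fun x hx y hy z hz =>
      ⟨hx.1.trans hz.1, (EReal.coe_le_coe_iff.2 hz.2).trans_lt hy.2⟩⟩
  refine uniqueDiffOn_convex hconn.convex ?_
  obtain ⟨c, hc0, hcR⟩ := EReal.lt_iff_exists_real_btwn.1 hR
  have hsub : {r : ℝ | 0 < r ∧ (r : EReal) < R} ⊆ {r : ℝ | 0 ≤ r ∧ (r : EReal) < R} :=
    fun r hr => ⟨le_of_lt hr.1, hr.2⟩
  exact ⟨c, interior_maximal hsub isOpen_setOf_pos_lt ⟨by exact_mod_cast hc0, hcR⟩⟩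

/-- A `C²` solution of the radial Pucci equation has a slope that is continuous up to the origin,
vanishes there, and solves the associated first order system. -/
lemma exists_slope_of_radial_solution (h0 : 0 < lam) (h : lam ≤ Lam) (hg : Continuous g)
    (hR : 0 < R) (hu : ContDiffOn ℝ 2 u {r : ℝ | 0 ≤ r ∧ (r : EReal) < R})
    (hode : ∀ r : ℝ, 0 < r → (r : EReal) < R →
      (if 0 ≤ deriv (deriv u) r then Lam else lam) * deriv (deriv u) r
        + ((l : ℝ) + 1) / r * ((if 0 ≤ deriv u r then Lam else lam) * deriv u r)
        + g (u r) = 0) :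
    ∃ w : ℝ → ℝ, ContinuousOn w {r : ℝ | 0 ≤ r ∧ (r : EReal) < R} ∧ w 0 = 0 ∧
      IsPucciFlow lam Lam l g u w {r : ℝ | 0 < r ∧ (r : EReal) < R} ∧
      ∀ r : ℝ, 0 < r → (r : EReal) < R → deriv u r = w r := by
  set D : Set ℝ := {r : ℝ | 0 ≤ r ∧ (r : EReal) < R} with hD
  set O : Set ℝ := {r : ℝ | 0 < r ∧ (r : EReal) < R} with hO
  have hOo : IsOpen O := isOpen_setOf_pos_lt
  have hOD : O ⊆ D := fun r hr => ⟨le_of_lt hr.1, hr.2⟩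
  have hDn : ∀ r ∈ O, D ∈ 𝓝 r := fun r hr => mem_of_superset (hOo.mem_nhds hr) hOD
  have hDu : UniqueDiffOn ℝ D := uniqueDiffOn_setOf_nonneg_lt hR
  set w : ℝ → ℝ := derivWithin u D with hw
  have hw1 : ContDiffOn ℝ 1 w D := hu.derivWithin hDu (by norm_num)
  have hwd : ∀ r ∈ O, deriv u r = w r := fun r hr => (derivWithin_of_mem_nhds (hDn r hr)).symm
  have hwdd : ∀ r ∈ O, deriv (deriv u) r = deriv w r := fun r hr =>
    Filter.EventuallyEq.deriv_eq (by filter_upwards [hOo.mem_nhds hr] with x hx using hwd x hx)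
  have hflow : IsPucciFlow lam Lam l g u w O := by
    intro r hr
    have h1 : DifferentiableAt ℝ u r :=
      (hu.differentiableOn (by norm_num)).differentiableAt (hDn r hr)
    have h2 : DifferentiableAt ℝ w r :=
      (hw1.differentiableOn (by norm_num)).differentiableAt (hDn r hr)
    refine ⟨hwd r hr ▸ h1.hasDerivAt, ?_⟩
    have h3 := (pucci_eq_iff h0 h r (u r) (deriv u r) _).1 (hode r hr.1 hr.2)
    rw [hwdd r hr, hwd r hr] at h3
    exact h3 ▸ h2.hasDerivAt
  refine ⟨w, hw1.continuousOn, ?_, hflow, fun r hr hrR => hwd r ⟨hr, hrR⟩⟩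
  have h0D : (0 : ℝ) ∈ D := ⟨le_rfl, by exact_mod_cast hR⟩
  have hle : ∀ r ∈ O, lam * |w r| ≤ r * (Lam * |derivWithin w D r| + |g (u r)|) := by
    intro r hr
    have hr0 : 0 < r := hr.1
    have h1 := hode r hr.1 hr.2
    have hL : 0 < Lam := h0.trans_le h
    rw [hwdd r hr, hwd r hr, ← derivWithin_of_mem_nhds (hDn r hr)] at h1
    set a := derivWithin w D r
    set A := (if 0 ≤ a then Lam else lam) * a
    set B := (if 0 ≤ w r then Lam else lam) * w r with hB
    have hA : |A| ≤ Lam * |a| := by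
      simp only [A, abs_mul]
      gcongr
      split_ifs
      · rw [abs_of_pos hL]
      · rwa [abs_of_pos h0]
    have hB' : lam * |w r| ≤ |B| := by
      rw [hB, abs_mul]
      gcongr
      split_ifs
      · rwa [abs_of_pos hL]
      · rw [abs_of_pos h0]
    have h2 : ((l : ℝ) + 1) * B = -(r * (A + g (u r))) := by
      have : ((l : ℝ) + 1) / r * B = -(A + g (u r)) := by linarith
      field_simp at this
      linarith
    have h3 : |B| ≤ |((l : ℝ) + 1) * B| := by
      rw [abs_mul ((l : ℝ) + 1) B, abs_of_pos (by positivity : (0 : ℝ) < (l : ℝ) + 1)]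
      exact le_mul_of_one_le_left (abs_nonneg _) (by linarith [Nat.cast_nonneg (α := ℝ) l])
    have h4 : |((l : ℝ) + 1) * B| = r * |A + g (u r)| := by
      rw [h2, abs_neg, abs_mul, abs_of_pos hr0]
    calc lam * |w r| ≤ r * |A + g (u r)| := (hB'.trans h3).trans h4.le
      _ ≤ r * (Lam * |a| + |g (u r)|) := by
        gcongr
        exact (abs_add_le _ _).trans (by gcongr)
  obtain ⟨c, hc0, hcR⟩ := EReal.lt_iff_exists_real_btwn.1 hR
  have hc0' : 0 < c := by exact_mod_cast hc0
  have hsub : Ioo 0 c ⊆ O := fun x hx =>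
    ⟨hx.1, (EReal.coe_lt_coe_iff.2 hx.2).trans hcR⟩
  have hcl : (0 : ℝ) ∈ closure (Ioo 0 c) := by
    rw [closure_Ioo hc0'.ne]; exact left_mem_Icc.2 hc0'.le
  have hwc : ContinuousWithinAt w D 0 := hw1.continuousOn 0 h0D
  have hw'c : ContinuousWithinAt (derivWithin w D) D 0 :=
    hw1.continuousOn_derivWithin hDu (by norm_num) 0 h0D
  have hguc : ContinuousWithinAt (fun r => g (u r)) D 0 :=
    hg.continuousAt.comp_continuousWithinAt (hu.continuousOn 0 h0D)
  have hfin := ContinuousWithinAt.closure_le hcl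
    (f := fun r => lam * |w r|) (g := fun r => r * (Lam * |derivWithin w D r| + |g (u r)|))
    (ContinuousWithinAt.mono (by fun_prop) (hsub.trans hOD))
    (ContinuousWithinAt.mono (continuousWithinAt_id.mul
      ((continuousWithinAt_const.mul hw'c.abs).add hguc.abs))
      (hsub.trans hOD)) fun r hr => hle r (hsub hr)
  simp only [zero_mul] at hfin
  exact abs_eq_zero.1 (le_antisymm (nonpos_of_mul_nonpos_right hfin h0) (abs_nonneg _))

end

/-- A function positive on `(0, ξ]`, vanishing at `0` with positive derivative there, dominates a
positive multiple of the identity on `(0, ξ]`. -/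
lemma exists_mul_le_of_hasDerivAt_pos {g : ℝ → ℝ} (hg : Continuous g) (hg0 : g 0 = 0) {d ξ : ℝ}
    (hd : HasDerivAt g d 0) (hd0 : 0 < d) (hξ : 0 < ξ) (hpos : ∀ t, 0 < t → t ≤ ξ → 0 < g t) :
    ∃ k > 0, ∀ t, 0 < t → t ≤ ξ → k * t ≤ g t := by
  have h1 := (hasDerivAt_iff_tendsto_slope.1 hd).mono_left
    (nhdsWithin_mono 0 (fun y (hy : 0 < y) => hy.ne') : 𝓝[>] (0 : ℝ) ≤ 𝓝[≠] 0)
  obtain ⟨δ, hδ, hsub⟩ := mem_nhdsGT_iff_exists_Ioo_subset.1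
    (h1.eventually (lt_mem_nhds (half_lt_self hd0)))
  have hδ0 : 0 < δ := hδ
  have hnear : ∀ t, 0 < t → t < δ → d / 2 * t ≤ g t := by
    intro t ht htδ
    have h2 : d / 2 < slope g 0 t := hsub ⟨ht, htδ⟩
    rw [slope_def_field, hg0, sub_zero, sub_zero, lt_div_iff₀ ht] at h2
    exact h2.le
  rcases lt_or_ge ξ δ with h | h
  · exact ⟨d / 2, by positivity, fun t ht htξ => hnear t ht (htξ.trans_lt h)⟩
  obtain ⟨s, hs, hmin⟩ := isCompact_Icc.exists_isMinOn (nonempty_Icc.2 h) hg.continuousOn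
  have hgs : 0 < g s := hpos s (hδ0.trans_le hs.1) hs.2
  refine ⟨min (d / 2) (g s / ξ), by positivity, fun t ht htξ => ?_⟩
  rcases lt_or_ge t δ with h2 | h2
  · exact (mul_le_mul_of_nonneg_right (min_le_left _ _) ht.le).trans (hnear t ht h2)
  · calc min (d / 2) (g s / ξ) * t ≤ g s / ξ * t := by gcongr; exact min_le_right _ _
      _ ≤ g s / ξ * ξ := by gcongr
      _ = g s := by field_simp
      _ ≤ g t := hmin ⟨h2, htξ⟩

/-- A solution of the radial system that continues `u` past `ρ` gives a `C²` continuation solving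
the radial Pucci equation. -/
lemma radial_extension_of_flow {lam Lam : ℝ} {l : ℕ} {g u U V : ℝ → ℝ} {ρ ε : ℝ} (h0 : 0 < lam)
    (h : lam ≤ Lam) (hg : Continuous g) (hρ : 0 < ρ)
    (hu : ContDiffOn ℝ 2 u {r : ℝ | 0 ≤ r ∧ (r : EReal) < (ρ : EReal)})
    (hU : ∀ r < ρ, U r = u r) (hflow : IsPucciFlow lam Lam l g U V (Ioo 0 (ρ + ε))) :
    ContDiffOn ℝ 2 U {r : ℝ | 0 ≤ r ∧ (r : EReal) < ((ρ + ε : ℝ) : EReal)} ∧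
      (∀ r : ℝ, 0 < r → (r : EReal) < ((ρ + ε : ℝ) : EReal) →
        (if 0 ≤ deriv (deriv U) r then Lam else lam) * deriv (deriv U) r
          + ((l : ℝ) + 1) / r * ((if 0 ≤ deriv U r then Lam else lam) * deriv U r)
          + g (U r) = 0) ∧ U =ᶠ[𝓝 0] u := by
  have heq : ∀ r < ρ, U =ᶠ[𝓝 r] u := fun r hr => by
    filter_upwards [Iio_mem_nhds hr] with x hx using hU x hx
  have hC2 : ContDiffOn ℝ 2 U (Ioo 0 (ρ + ε)) :=
    contDiffOn_two_of_hasDerivAt isOpen_Ioo (fun x hx => (hflow x hx).1)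
      (fun x hx => (hflow x hx).2) fun x hx =>
        (continuousAt_pucciAccel hg hx.1.ne' (hflow x hx).1.continuousAt
          (hflow x hx).2.continuousAt).continuousWithinAt
  refine ⟨fun r hr => ?_, fun r hr hr2 => ?_, heq 0 hρ⟩
  · have hr2 : r < ρ + ε := EReal.coe_lt_coe_iff.1 hr.2
    rcases lt_or_ge r ρ with h1 | h1
    · have h2 := hu r ⟨hr.1, EReal.coe_lt_coe_iff.2 h1⟩
      have h3 : {r : ℝ | 0 ≤ r ∧ (r : EReal) < (ρ : EReal)} ∈
          𝓝[{r : ℝ | 0 ≤ r ∧ (r : EReal) < ((ρ + ε : ℝ) : EReal)}] r := by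
        filter_upwards [self_mem_nhdsWithin, mem_nhdsWithin_of_mem_nhds (Iio_mem_nhds h1)]
          with x hx hx2 using ⟨hx.1, EReal.coe_lt_coe_iff.2 hx2⟩
      exact (h2.mono_of_mem_nhdsWithin h3).congr_of_eventuallyEq
        ((heq r h1).filter_mono nhdsWithin_le_nhds) (hU r h1)
    · exact (hC2.contDiffAt (Ioo_mem_nhds (hρ.trans_le h1) hr2)).contDiffWithinAt
  · have hr3 : r ∈ Ioo 0 (ρ + ε) := ⟨hr, EReal.coe_lt_coe_iff.1 hr2⟩
    have hd : deriv U =ᶠ[𝓝 r] V := by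
      filter_upwards [Ioo_mem_nhds hr3.1 hr3.2] with x hx using (hflow x hx).1.deriv
    rw [hd.deriv_eq, hd.eq_of_nhds, (hflow r hr3).2.deriv]
    exact (pucci_eq_iff h0 h r (U r) (V r) _).2 rfl

theorem pucci_radial_plus_first_zero
    (lam Lam : ℝ) (hlam : 0 < lam) (hlamLam : lam ≤ Lam)
    (N : ℕ) (hN : 2 ≤ N)
    (g : ℝ → ℝ) (hg1 : LocallyLipschitz g)
    (hg2 : ∀ t, g (-t) = - g t)
    (α : ℝ) (hα : 0 < α)
    (hg3pos : ∀ t, 0 < t → t < α → 0 < g t)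
    (hg3neg : ∀ t, α < t → g t < 0)
    (g'0 : ℝ) (hg4 : HasDerivAt g g'0 0) (hg4pos : 0 < g'0)
    (ξ : ℝ) (hξ0 : 0 < ξ) (hξα : ξ < α)
    (R : EReal) (hR : 0 < R)
    (u : ℝ → ℝ)
    (hu : ContDiffOn ℝ 2 u {r : ℝ | 0 ≤ r ∧ (r : EReal) < R})
    (hode : ∀ r : ℝ, 0 < r → (r : EReal) < R →
      (if 0 ≤ deriv (deriv u) r then Lam else lam) * deriv (deriv u) r
        + ((N : ℝ) - 1) / r * ((if 0 ≤ deriv u r then Lam else lam) * deriv u r)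
        + g (u r) = 0)
    (hu0 : u 0 = ξ) (hu'0 : deriv u 0 = 0)
    (hmax : ¬ ∃ (R' : EReal) (v : ℝ → ℝ), R < R' ∧
      ContDiffOn ℝ 2 v {r : ℝ | 0 ≤ r ∧ (r : EReal) < R'} ∧
      (∀ r : ℝ, 0 < r → (r : EReal) < R' →
        (if 0 ≤ deriv (deriv v) r then Lam else lam) * deriv (deriv v) r
        + ((N : ℝ) - 1) / r * ((if 0 ≤ deriv v r then Lam else lam) * deriv v r)
        + g (v r) = 0) ∧
      v 0 = ξ ∧ deriv v 0 = 0 ∧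
      (∀ r : ℝ, 0 ≤ r → (r : EReal) < R → v r = u r))
 :
    ∃ r₁ : ℝ, 0 < r₁ ∧ (r₁ : EReal) < R ∧ u r₁ = 0 ∧
      (∀ r, 0 ≤ r → r < r₁ → 0 < u r) ∧
      (∀ r, 0 < r → r ≤ r₁ → deriv u r < 0) := by
  obtain ⟨l, rfl⟩ : ∃ l, N = l + 2 := ⟨N - 2, by omega⟩
  have hN1 : (((l + 2 : ℕ) : ℝ) - 1) = (l : ℝ) + 1 := by push_cast; ring
  simp only [hN1] at hode hmax
  have hgc : Continuous g := hg1.continuous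
  have hg0 : g 0 = 0 := by
    have := hg2 0
    rw [neg_zero] at this
    linarith
  obtain ⟨w, hwc, hw0, hflow, hderiv⟩ :=
    exists_slope_of_radial_solution hlam hlamLam hgc hR hu hode
  have hsub : ∀ T : ℝ, (T : EReal) < R → Icc 0 T ⊆ {r : ℝ | 0 ≤ r ∧ (r : EReal) < R} :=
    fun T hT x hx => ⟨hx.1, (EReal.coe_le_coe_iff.2 hx.2).trans_lt hT⟩
  have hslope : ∀ T : ℝ, 0 < T → (T : EReal) < R → (∀ r ∈ Ico 0 T, 0 < u r) →
      ∀ r ∈ Ioc 0 T, w r < 0 := fun T hT hTR hpos =>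
    slope_neg_of_pos hlam hlamLam hT hg3pos (hu.continuousOn.mono (hsub T hTR))
      (hwc.mono (hsub T hTR)) hw0 (hu0 ▸ hξα)
      (fun r hr => hflow r ⟨hr.1, (EReal.coe_le_coe_iff.2 hr.2).trans_lt hTR⟩) hpos
  by_cases hzero : ∃ r : ℝ, 0 ≤ r ∧ (r : EReal) < R ∧ u r ≤ 0
  · obtain ⟨T, hT, hTR, huT⟩ := hzero
    have huc : ContinuousOn u (Icc 0 T) := hu.continuousOn.mono (hsub T hTR)
    have hcl : IsCompact (Icc 0 T ∩ u ⁻¹' Iic 0) :=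
      isCompact_Icc.of_isClosed_subset (huc.preimage_isClosed_of_isClosed isClosed_Icc isClosed_Iic)
        inter_subset_left
    obtain ⟨s, ⟨hs, hus⟩, hmin⟩ := hcl.exists_isLeast ⟨T, ⟨hT, le_rfl⟩, huT⟩
    have hpos : ∀ r, 0 ≤ r → r < s → 0 < u r := by
      intro r hr hrs
      by_contra! hc
      exact absurd (hmin ⟨⟨hr, hrs.le.trans hs.2⟩, hc⟩) (not_le.2 hrs)
    have hs0 : 0 < s := by
      refine hs.1.lt_of_ne ?_
      rintro rfl
      have : u 0 ≤ 0 := hus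
      linarith
    have hsR : (s : EReal) < R := (EReal.coe_le_coe_iff.2 hs.2).trans_lt hTR
    have hus0 : u s = 0 := by
      refine le_antisymm hus ?_
      refine ContinuousWithinAt.closure_le (s := Ico 0 s) (f := fun _ => 0)
        (by rw [closure_Ico hs0.ne]; exact right_mem_Icc.2 hs.1) continuousWithinAt_const
        ((huc s hs).mono fun x hx => ⟨hx.1, hx.2.le.trans hs.2⟩) fun r hr => (hpos r hr.1 hr.2).le
    refine ⟨s, hs0, hsR, hus0, hpos, fun r hr hrs => ?_⟩
    rw [hderiv r hr ((EReal.coe_le_coe_iff.2 hrs).trans_lt hsR)]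
    exact hslope s hs0 hsR (fun x hx => hpos x hx.1 hx.2) r ⟨hr, hrs⟩
  exfalso
  push Not at hzero
  have hw : ∀ r : ℝ, 0 < r → (r : EReal) < R → w r < 0 := fun r hr hrR =>
    hslope r hr hrR (fun x hx => hzero x hx.1 ((EReal.coe_lt_coe_iff.2 hx.2).trans hrR)) r
      ⟨hr, le_rfl⟩
  have huξ : ∀ r : ℝ, 0 < r → (r : EReal) < R → u r ≤ ξ := by
    intro r hr hrR
    have hanti : AntitoneOn u (Icc 0 r) := by
      refine antitoneOn_of_hasDerivAt_nonpos (f' := w) (convex_Icc 0 r)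
        (hu.continuousOn.mono (hsub r hrR)) ?_ ?_ <;> rw [interior_Icc] <;> intro x hx
      · exact (hflow x ⟨hx.1, (EReal.coe_lt_coe_iff.2 hx.2).trans hrR⟩).1
      · exact (hw x hx.1 ((EReal.coe_lt_coe_iff.2 hx.2).trans hrR)).le
    exact hu0 ▸ hanti (left_mem_Icc.2 hr.le) (right_mem_Icc.2 hr.le) hr.le
  induction R with
  | bot => exact absurd hR (by simp)
  | top =>
    have hD : {r : ℝ | 0 ≤ r ∧ (r : EReal) < ⊤} = Ici 0 := by ext x; simp [EReal.coe_lt_top]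
    have huc := hu.continuousOn
    rw [hD] at huc hwc
    obtain ⟨k, hk, hkg⟩ := exists_mul_le_of_hasDerivAt_pos hgc hg0 hg4 hg4pos hξ0
      fun t ht htξ => hg3pos t ht (htξ.trans_lt hξα)
    have hpos : ∀ r, 0 < r → 0 < u r := fun r hr => hzero r hr.le (EReal.coe_lt_top r)
    exact not_pos_on_halfline hlam hlamLam hk huc hwc
      (fun r hr => hflow r ⟨hr, EReal.coe_lt_top r⟩) (fun r hr => hw r hr (EReal.coe_lt_top r))
      (fun r hr => hkg _ (hpos r hr) (huξ r hr (EReal.coe_lt_top r))) hpos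
  | coe ρ =>
    have hρ : 0 < ρ := by exact_mod_cast hR
    have hlt : ∀ r ∈ Ioo 0 ρ, (r : EReal) < ρ := fun r hr => EReal.coe_lt_coe_iff.2 hr.2
    have hpos : ∀ r ∈ Ioo 0 ρ, 0 < u r := fun r hr => hzero r hr.1.le (hlt r hr)
    have hfl : IsPucciFlow lam Lam l g u w (Ioo 0 ρ) := fun r hr => hflow r ⟨hr.1, hlt r hr⟩
    obtain ⟨s, -, hs⟩ := isCompact_Icc.exists_isMaxOn (nonempty_Icc.2 hξ0.le)
      (hgc.continuousOn (s := Icc 0 ξ))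
    obtain ⟨⟨a, ha⟩, b, hb⟩ := hfl.exists_tendsto (C := g s) hlam hlamLam hρ
      (fun r hr => hw r hr.1 (hlt r hr)) hpos fun r hr =>
        ⟨(hg3pos _ (hpos r hr) ((huξ r hr.1 (hlt r hr)).trans_lt hξα)).le,
          hs ⟨(hpos r hr).le, huξ r hr.1 (hlt r hr)⟩⟩
    obtain ⟨ε, hε, U, V, hU, hUV⟩ := hfl.exists_extension hg1 hρ ha hb
    obtain ⟨h1, h2, h3⟩ := radial_extension_of_flow hlam hlamLam hgc hρ hu hU hUV
    exact hmax ⟨((ρ + ε : ℝ) : EReal), U, EReal.coe_lt_coe_iff.2 (by linarith), h1, h2,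
      h3.eq_of_nhds.trans hu0, h3.deriv_eq.trans hu'0,
      fun r _ hr => hU r (EReal.coe_lt_coe_iff.1 hr)⟩
end
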